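/- Let φ : X → ℝ be a normalized potential with summable variation and unique equilibrium state μ_φ, and assume φ is NOT of the form u − u∘θ − log|A| for a continuous u : X → ℝ. Then: (i) the limit γ^+(μ_φ) = lim_n (1/n) log max_{a_1^n} μ_φ(a_1^n) exists; (ii) the unique solution q*_φ of P((1−q)φ) = sup_η ∫ φ dη lies in (−1, 0); (iii) for every q ∈ ℝ the limit R_{μ_φ}(q) = lim_n (1/n) log ∫ R_n^q dμ_φ exists, and R_{μ_φ}(q) = P((1−q)φ) for q ≥ q*_φ, while R_{μ_φ}(q) = γ^+(μ_φ) = sup_η ∫ φ dη for q ≤ q*_φ, the supremum being over all shift-invariant Borel probability measures η. -/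

import Mathlib

open MeasureTheory Filter Topology Set

namespace RTSpec

variable (A : Type*) [Fintype A] [TopologicalSpace A] [DiscreteTopology A]
  [MeasurableSpace A] [BorelSpace A]

/-- The sequence space `X = A^ℕ` (0-indexed: `x 0` is the paper's `x₁`). -/
abbrev X := ℕ → A

/-- The shift map `θ`. -/
def shift : X A → X A := fun x n => x (n + 1)

/-- The cylinder `[a_1^n]` based on the word `w = a_1^n`. -/
def cyl {n : ℕ} (w : Fin n → A) : Set (X A) := {x | ∀ i : Fin n, x i.val = w i}

/-- Return time `R_n(x) = inf {k ≥ 2 : x_k^{k+n-1} = x_1^n}` (with `sInf ∅ = 0`). -/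
noncomputable def retTime (n : ℕ) (x : X A) : ℕ := sInf {k | 2 ≤ k ∧ ∀ i < n, x (k - 1 + i) = x i}

/-- Hitting time `T_{a_1^n}(y) = inf {k ≥ 1 : y_k^{k+n-1} = a_1^n}`. -/
noncomputable def hitTime {n : ℕ} (w : Fin n → A) (y : X A) : ℕ :=
  sInf {k | 1 ≤ k ∧ ∀ i : Fin n, y (k - 1 + i.val) = w i}

/-- Hitting/return time in the shifted sense: `inf {k ≥ 1 : θ^k y ∈ [a_1^n]}`. -/
noncomputable def hitTime' {n : ℕ} (w : Fin n → A) (y : X A) : ℕ :=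
  sInf {k | 1 ≤ k ∧ ∀ i : Fin n, y (k + i.val) = w i}

/-- `τ(a_1^n) = inf {k ≥ 1 : [a_1^n] ∩ θ^{-k}[a_1^n] ≠ ∅}`, the smallest return time
of the cylinder `[a_1^n]`. -/
noncomputable def tau {n : ℕ} (w : Fin n → A) : ℕ :=
  sInf {k | 1 ≤ k ∧ (cyl A w ∩ {y | ∀ i : Fin n, y (k + i.val) = w i}).Nonempty}

/-- `ζ_μ(a_1^n) = μ([a_1^n] ∩ {T_{a_1^n} ≠ τ(a_1^n)}) / μ([a_1^n])`. -/
noncomputable def zeta (μ : Measure (X A)) {n : ℕ} (w : Fin n → A) : ℝ :=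
  (μ (cyl A w ∩ {y | hitTime' A w y ≠ tau A w})).toReal / (μ (cyl A w)).toReal

/-- A shift-invariant Borel probability measure. -/
def InvProb (η : Measure (X A)) : Prop :=
  IsProbabilityMeasure η ∧ Measure.map (shift A) η = η

/-- The `n`-th term `-(1/n) Σ_{a_1^n} μ(a_1^n) log μ(a_1^n)` of the entropy sequence. -/
noncomputable def entSeq (μ : Measure (X A)) (n : ℕ) : ℝ :=
  -(1 / (n : ℝ)) * ∑ w : Fin n → A, (μ (cyl A w)).toReal * Real.log (μ (cyl A w)).toReal

/-- The entropy `h(μ)`, i.e. the limit of `entSeq` (which always exists for a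
shift-invariant measure; we realize it as a liminf). -/
noncomputable def entropy (μ : Measure (X A)) : ℝ := atTop.liminf (entSeq A μ)

/-- Topological pressure `P(ψ) = sup_η {h(η) + ∫ ψ dη}`, the supremum running over
all shift-invariant probability measures. -/
noncomputable def pressure (ψ : X A → ℝ) : ℝ :=
  sSup {r | ∃ η : Measure (X A), InvProb A η ∧ r = entropy A η + ∫ x, ψ x ∂η}

/-- `sup_η ∫ φ dη` over shift-invariant probability measures. -/
noncomputable def supInt (φ : X A → ℝ) : ℝ :=
  sSup {r | ∃ η : Measure (X A), InvProb A η ∧ r = ∫ x, φ x ∂η}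

/-- `inf_η ∫ φ dη` over shift-invariant probability measures. -/
noncomputable def infInt (φ : X A → ℝ) : ℝ :=
  sInf {r | ∃ η : Measure (X A), InvProb A η ∧ r = ∫ x, φ x ∂η}

/-- `var_n(φ) = sup {|φ(x) - φ(y)| : x_1^n = y_1^n}`. -/
noncomputable def Var (φ : X A → ℝ) (n : ℕ) : ℝ :=
  sSup {r | ∃ x y : X A, (∀ i < n, x i = y i) ∧ r = |φ x - φ y|}

/-- Prepending a symbol: `ax = (a, x_1, x_2, …)`. -/
def prepend (a : A) (x : X A) : X A := fun n => Nat.casesOn n a x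

/-- A potential `φ` is normalized if `Σ_{a ∈ A} e^{φ(ax)} = 1` for all `x`. -/
def Normalized (φ : X A → ℝ) : Prop :=
  ∀ x : X A, ∑ a : A, Real.exp (φ (prepend A a x)) = 1

/-- `μ` is an equilibrium state for `φ`: a probability measure fixed by the dual
transfer operator, i.e. `∫ L_φ f dμ = ∫ f dμ` for every continuous `f`. -/
def IsEqSt (φ : X A → ℝ) (μ : Measure (X A)) : Prop :=
  IsProbabilityMeasure μ ∧ ∀ f : X A → ℝ, Continuous f →
    ∫ x, (∑ a : A, Real.exp (φ (prepend A a x)) * f (prepend A a x)) ∂μ = ∫ x, f x ∂μ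

/-- The `n`-th term `(1/n) log ∫ R_n^q dμ` of the return-time `L^q`-spectrum,
with values in `EReal` (the integral may be infinite). -/
noncomputable def RSeq (μ : Measure (X A)) (q : ℝ) (n : ℕ) : EReal :=
  (((n : ℝ)⁻¹ : ℝ) : EReal) *
    ENNReal.log (∫⁻ x, ENNReal.ofReal ((retTime A n x : ℝ) ^ q) ∂μ)

/-- The `n`-th term `(1/n) log Σ_{a_1^n} μ(a_1^n)^{1-q}` of the `L^q`-spectrum of `μ`. -/
noncomputable def MSeq (μ : Measure (X A)) (q : ℝ) (n : ℕ) : ℝ :=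
  (1 / (n : ℝ)) * Real.log (∑ w : Fin n → A, (μ (cyl A w)).toReal ^ (1 - q))

/-- `Λ^{(n)}(μ) = (1/n) log Σ_{a_1^n} (1 - ζ_μ(a_1^n)) μ(a_1^n)`. -/
noncomputable def LamSeq (μ : Measure (X A)) (n : ℕ) : ℝ :=
  (1 / (n : ℝ)) * Real.log (∑ w : Fin n → A, (1 - zeta A μ w) * (μ (cyl A w)).toReal)

/-- `(1/n) log max_{a_1^n} μ(a_1^n)`. -/
noncomputable def gammaSeq (μ : Measure (X A)) (n : ℕ) : ℝ :=
  (1 / (n : ℝ)) * Real.log (⨆ w : Fin n → A, (μ (cyl A w)).toReal)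

/-- `μ` is φ-mixing with rate `ϕ`: `ϕ` decreases to `0` and for all `n, ℓ ≥ 1`,
all `S` in the σ-algebra generated by coordinates `1, …, n` with `μ S ≠ 0`, and
all `T` in the σ-algebra generated by coordinates `n+ℓ, n+ℓ+1, …`,
`|μ(S ∩ T)/μ(S) - μ(T)| ≤ ϕ(ℓ)`. -/
def PhiMixing (μ : Measure (X A)) (ϕ : ℕ → ℝ) : Prop :=
  (∀ ℓ, 0 < ϕ ℓ) ∧ Antitone ϕ ∧ Tendsto ϕ atTop (nhds 0) ∧
  ∀ n ℓ : ℕ, 1 ≤ n → 1 ≤ ℓ →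
    ∀ S T : Set (X A),
      MeasurableSet[MeasurableSpace.comap
        (fun x : X A => fun i : Fin n => x i.val) inferInstance] S →
      MeasurableSet[MeasurableSpace.comap
        (fun x : X A => fun j : ℕ => x (n + ℓ - 1 + j)) inferInstance] T →
      μ S ≠ 0 →
      |(μ (S ∩ T)).toReal / (μ S).toReal - (μ T).toReal| ≤ ϕ ℓ

set_option linter.unusedSectionVars false

section Words
variable {A}

theorem iterate_shift_apply (k : ℕ) (x : X A) (i : ℕ) : (shift A)^[k] x i = x (i + k) := by
  induction k generalizing x i with
  | zero => rfl
  | succ k ih => rw [Function.iterate_succ_apply, ih]; rfl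

theorem continuous_shift : Continuous (shift A) :=
  continuous_pi fun n => continuous_apply (n + 1)

theorem continuous_iterate_shift (k : ℕ) : Continuous ((shift A)^[k]) :=
  continuous_shift.iterate k

theorem continuous_prepend (a : A) : Continuous (prepend A a) := by
  refine continuous_pi fun n => ?_
  cases n with
  | zero => exact continuous_const
  | succ n => exact continuous_apply n

theorem shift_prepend (a : A) (x : X A) : shift A (prepend A a x) = x := rfl

/-- The concatenation of a finite word with a sequence. -/
def wcat {n : ℕ} (w : Fin n → A) (x : X A) : X A :=
  fun i => if h : i < n then w ⟨i, h⟩ else x (i - n)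

theorem wcat_of_lt {n : ℕ} (w : Fin n → A) (x : X A) {i : ℕ} (h : i < n) :
    wcat w x i = w ⟨i, h⟩ := dif_pos h

theorem wcat_add {n : ℕ} (w : Fin n → A) (x : X A) (i : ℕ) : wcat w x (i + n) = x i := by
  simp [wcat]

theorem iterate_shift_wcat {n : ℕ} (w : Fin n → A) (x : X A) :
    (shift A)^[n] (wcat w x) = x := by
  ext i; rw [iterate_shift_apply, wcat_add]

theorem prepend_wcat {n : ℕ} (a : A) (w : Fin n → A) (x : X A) :
    prepend A a (wcat w x) = wcat (Fin.cons a w : Fin (n + 1) → A) x := by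
  ext i
  cases i with
  | zero => simp [prepend, wcat]
  | succ i =>
    by_cases h : i < n
    · have h2 : i + 1 < n + 1 := by omega
      rw [wcat_of_lt _ _ h2]
      change wcat w x i = _
      rw [wcat_of_lt _ _ h]
      rfl
    · change wcat w x i = _
      simp [wcat, h]

theorem continuous_wcat {n : ℕ} (w : Fin n → A) : Continuous (wcat w) := by
  refine continuous_pi fun i => ?_
  by_cases h : i < n
  · simp only [wcat, h, dite_true]; exact continuous_const
  · simp only [wcat, h, dite_false]; exact continuous_apply _

/-- The set of sequences that agree with `z` on the first `n` coordinates. -/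
def box (n : ℕ) (z : X A) : Set (X A) := {x | ∀ i < n, x i = z i}

theorem isClopen_coord_eq (i : ℕ) (a : A) : IsClopen {x : X A | x i = a} :=
  (isClopen_discrete ({a} : Set A)).preimage (continuous_apply i)

theorem isClopen_box (n : ℕ) (z : X A) : IsClopen (box n z) := by
  have : box n z = ⋂ i ∈ Finset.range n, {x : X A | x i = z i} := by
    ext x; simp [box]
  rw [this]
  exact isClopen_biInter_finset fun i _ => isClopen_coord_eq i (z i)

theorem cyl_eq_box {n : ℕ} (w : Fin n → A) (x : X A) : cyl A w = box n (wcat w x) := by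
  ext y
  simp only [cyl, box, mem_ofPred_eq]
  constructor
  · intro h i hi; rw [wcat_of_lt _ _ hi]; exact h ⟨i, hi⟩
  · intro h i; rw [h i.1 i.2, wcat_of_lt _ _ i.2]

theorem cyl_restrict (n : ℕ) (z : X A) : cyl A (fun i : Fin n => z i) = box n z := by
  ext y
  exact ⟨fun h i hi => h ⟨i, hi⟩, fun h i => h i.1 i.2⟩

theorem isClopen_cyl [Nonempty A] {n : ℕ} (w : Fin n → A) : IsClopen (cyl A w) := by
  rw [cyl_eq_box w (fun _ => Classical.arbitrary A)]; exact isClopen_box _ _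

theorem wcat_mem_cyl {n : ℕ} (w : Fin n → A) (x : X A) : wcat w x ∈ cyl A w :=
  fun i => wcat_of_lt _ _ i.2

theorem mem_cyl_iff {n : ℕ} (w : Fin n → A) (x : X A) :
    x ∈ cyl A w ↔ (fun i : Fin n => x i) = w :=
  ⟨fun h => funext h, fun h i => congrFun h i⟩

/-- The indicator of a clopen set as a real function is continuous. -/
theorem continuous_indicator_one {S : Set (X A)} (hS : IsClopen S) :
    Continuous (S.indicator (fun _ => (1 : ℝ))) :=
  hS.continuous_indicator continuous_const

/-- The transfer operator `L_φ`. -/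
noncomputable def transfer (φ : X A → ℝ) (f : X A → ℝ) (x : X A) : ℝ :=
  ∑ a : A, Real.exp (φ (prepend A a x)) * f (prepend A a x)

theorem continuous_transfer {φ f : X A → ℝ} (hφ : Continuous φ) (hf : Continuous f) :
    Continuous (transfer φ f) :=
  continuous_finsetSum _ fun a _ =>
    (Real.continuous_exp.comp (hφ.comp (continuous_prepend a))).mul
      (hf.comp (continuous_prepend a))

theorem continuous_iterate_transfer {φ f : X A → ℝ} (hφ : Continuous φ) (hf : Continuous f)
    (n : ℕ) : Continuous ((transfer φ)^[n] f) := by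
  induction n with
  | zero => exact hf
  | succ n ih => rw [Function.iterate_succ_apply']; exact continuous_transfer hφ ih

theorem iterate_transfer_apply (φ f : X A → ℝ) (n : ℕ) (x : X A) :
    (transfer φ)^[n] f x =
      ∑ w : Fin n → A, Real.exp (birkhoffSum (shift A) φ n (wcat w x)) * f (wcat w x) := by
  induction n generalizing f with
  | zero =>
    have : ∀ w : Fin 0 → A, wcat w x = x := fun w => by ext i; simp [wcat]
    simp [this]
  | succ n ih =>
    rw [Function.iterate_succ_apply, ih]
    rw [← (Fin.consEquiv (fun _ : Fin (n + 1) => A)).sum_comp, Fintype.sum_prod_type,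
      Finset.sum_comm]
    refine Finset.sum_congr rfl fun w _ => ?_
    rw [transfer, Finset.mul_sum]
    refine Finset.sum_congr rfl fun a _ => ?_
    change _ = Real.exp (birkhoffSum (shift A) φ (n + 1) (wcat (Fin.cons a w) x)) *
      f (wcat (Fin.cons a w) x)
    rw [← prepend_wcat, birkhoffSum_succ', shift_prepend, Real.exp_add]
    ring

theorem continuous_birkhoffSum {φ : X A → ℝ} (hφ : Continuous φ) (n : ℕ) :
    Continuous (birkhoffSum (shift A) φ n) :=
  continuous_finsetSum _ fun k _ => hφ.comp (continuous_iterate_shift k)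

end Words

section Gibbs
variable {A}

/-- `φ` is a normalized potential of summable variation and `μ` is an equilibrium state for it. -/
structure Equilibrium (φ : X A → ℝ) (μ : Measure (X A)) : Prop where
  card : 1 < Fintype.card A
  cont : Continuous φ
  summable : Summable (fun n => Var A φ (n + 1))
  norm : Normalized A φ
  eqst : IsEqSt A φ μ

/-- The tail sums of the variations of `φ`. -/
noncomputable def tail (φ : X A → ℝ) (k : ℕ) : ℝ := ∑' j, Var A φ (j + k + 1)

namespace Equilibrium

variable {φ : X A → ℝ} {μ : Measure (X A)} (H : Equilibrium φ μ)
include H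

theorem isProb : IsProbabilityMeasure μ := H.eqst.1

theorem nonempty : Nonempty A := Fintype.card_pos_iff.1 (by have := H.card; omega)

theorem exists_bound : ∃ B : ℝ, 0 < B ∧ ∀ x, |φ x| ≤ B := by
  obtain ⟨B, hB⟩ := (isCompact_univ (X := X A)).exists_bound_of_continuousOn H.cont.continuousOn
  refine ⟨max B 1, by positivity, fun x => le_max_of_le_left ?_⟩
  simpa using hB x (mem_univ x)

theorem abs_sub_le_Var {n : ℕ} {x y : X A} (h : ∀ i < n, x i = y i) :
    |φ x - φ y| ≤ Var A φ n := by
  obtain ⟨B, -, hB⟩ := H.exists_bound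
  refine le_csSup ⟨B + B, ?_⟩ ⟨x, y, h, rfl⟩
  rintro r ⟨u, v, -, rfl⟩
  exact (abs_sub _ _).trans (add_le_add (hB u) (hB v))

theorem Var_nonneg (n : ℕ) : 0 ≤ Var A φ n := by
  obtain ⟨a⟩ := H.nonempty
  exact (abs_nonneg _).trans (H.abs_sub_le_Var (x := fun _ => a) (y := fun _ => a) fun _ _ => rfl)

theorem summable_shifted (k : ℕ) : Summable (fun j => Var A φ (j + k + 1)) :=
  (summable_nat_add_iff (f := fun n => Var A φ (n + 1)) k).2 H.summable

theorem tail_nonneg (k : ℕ) : 0 ≤ tail φ k := tsum_nonneg fun _ => H.Var_nonneg _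

theorem tendsto_tail : Tendsto (tail φ) atTop (𝓝 0) :=
  tendsto_sum_nat_add fun n => Var A φ (n + 1)

theorem abs_birkhoffSum_sub_le {n k : ℕ} {x y : X A} (h : ∀ i < n + k, x i = y i) :
    |birkhoffSum (shift A) φ n x - birkhoffSum (shift A) φ n y| ≤ tail φ k := by
  have h1 : |birkhoffSum (shift A) φ n x - birkhoffSum (shift A) φ n y| ≤
      ∑ i ∈ Finset.range n, Var A φ (n - 1 - i + k + 1) := by
    rw [birkhoffSum, birkhoffSum, ← Finset.sum_sub_distrib]
    refine (Finset.abs_sum_le_sum_abs _ _).trans (Finset.sum_le_sum fun i hi => ?_)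
    refine H.abs_sub_le_Var fun j hj => ?_
    rw [iterate_shift_apply, iterate_shift_apply]
    have := Finset.mem_range.1 hi
    exact h _ (by omega)
  rw [Finset.sum_range_reflect (fun i => Var A φ (i + k + 1)) n] at h1
  exact h1.trans ((H.summable_shifted k).sum_le_tsum _ fun _ _ => H.Var_nonneg _)

theorem birkhoffSum_le_add {n : ℕ} {x y : X A} (h : ∀ i < n, x i = y i) :
    birkhoffSum (shift A) φ n x ≤ birkhoffSum (shift A) φ n y + tail φ 0 := by
  have := (abs_le.1 (H.abs_birkhoffSum_sub_le (n := n) (k := 0) (x := x) (y := y)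
    (by simpa using h))).2
  linarith

theorem exists_neg_bound : ∃ κ : ℝ, 0 < κ ∧ ∀ x, φ x ≤ -κ := by
  classical
  obtain ⟨B, hB0, hB⟩ := H.exists_bound
  have hlt : ∀ x, Real.exp (φ x) ≤ 1 - Real.exp (-B) := by
    intro x
    obtain ⟨b, hb⟩ := Fintype.exists_ne_of_one_lt_card H.card (x 0)
    have hx : prepend A (x 0) (shift A x) = x := by
      ext i; cases i <;> rfl
    have h := H.norm (shift A x)
    have h2 : Real.exp (φ (prepend A (x 0) (shift A x))) + Real.exp (φ (prepend A b (shift A x)))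
        ≤ 1 := by
      rw [← h, ← Finset.sum_pair (f := fun a => Real.exp (φ (prepend A a (shift A x)))) hb.symm]
      exact Finset.sum_le_sum_of_subset_of_nonneg (Finset.subset_univ _)
        fun _ _ _ => (Real.exp_pos _).le
    rw [hx] at h2
    have h3 : Real.exp (-B) ≤ Real.exp (φ (prepend A b (shift A x))) :=
      Real.exp_le_exp.2 (abs_le.1 (hB _)).1
    linarith
  obtain ⟨a⟩ := H.nonempty
  have hpos : 0 < 1 - Real.exp (-B) := (Real.exp_pos _).trans_le (hlt fun _ => a)
  refine ⟨-Real.log (1 - Real.exp (-B)), ?_, fun x => ?_⟩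
  · have := Real.log_neg hpos (by linarith [Real.exp_pos (-B)])
    linarith
  · rw [neg_neg, Real.le_log_iff_exp_le hpos]
    exact hlt x

theorem iterate_transfer_one (n : ℕ) : (transfer φ)^[n] (fun _ => 1) = fun _ => 1 := by
  induction n with
  | zero => rfl
  | succ n ih =>
    rw [Function.iterate_succ_apply', ih]
    ext x; simpa [transfer] using H.norm x

theorem integral_iterate_transfer {f : X A → ℝ} (hf : Continuous f) (n : ℕ) :
    ∫ x, (transfer φ)^[n] f x ∂μ = ∫ x, f x ∂μ := by
  induction n with
  | zero => rfl
  | succ n ih =>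
    rw [Function.iterate_succ_apply', ← ih]
    exact H.eqst.2 _ (continuous_iterate_transfer H.cont hf n)

omit H in
theorem iterate_transfer_mul_comp (g F : X A → ℝ) (n : ℕ) (x : X A) :
    (transfer φ)^[n] (fun y => g y * F ((shift A)^[n] y)) x = (transfer φ)^[n] g x * F x := by
  rw [iterate_transfer_apply, iterate_transfer_apply, Finset.sum_mul]
  refine Finset.sum_congr rfl fun w _ => ?_
  rw [iterate_shift_wcat, mul_assoc]

theorem integral_mul_comp {g F : X A → ℝ} (hg : Continuous g) (hF : Continuous F) (n : ℕ) :
    ∫ x, g x * F ((shift A)^[n] x) ∂μ = ∫ x, (transfer φ)^[n] g x * F x ∂μ := by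
  refine (H.integral_iterate_transfer
    (hg.mul (hF.comp (continuous_iterate_shift n))) n).symm.trans ?_
  exact integral_congr_ae (ae_of_all _ fun x => iterate_transfer_mul_comp g F n x)

theorem integral_comp_iterate {F : X A → ℝ} (hF : Continuous F) (n : ℕ) :
    ∫ x, F ((shift A)^[n] x) ∂μ = ∫ x, F x ∂μ := by
  have := H.integral_mul_comp continuous_const hF n (g := fun _ => 1)
  simpa [H.iterate_transfer_one n] using this

theorem integrable {f : X A → ℝ} (hf : Continuous f) : Integrable f μ := by
  have := H.isProb
  obtain ⟨B, hB⟩ := (isCompact_univ (X := X A)).exists_bound_of_continuousOn hf.continuousOn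
  exact Integrable.of_bound hf.aestronglyMeasurable B (ae_of_all _ fun x => hB x (mem_univ x))

omit H in
theorem integral_indicator_clopen {S : Set (X A)} (hS : IsClopen S) :
    ∫ x, S.indicator (fun _ => (1 : ℝ)) x ∂μ = μ.real S := by
  rw [integral_indicator hS.isOpen.measurableSet]; simp

theorem real_preimage {T : Set (X A)} (hT : IsClopen T) (n : ℕ) :
    μ.real ((shift A)^[n] ⁻¹' T) = μ.real T := by
  rw [← integral_indicator_clopen hT,
    ← integral_indicator_clopen (hT.preimage (continuous_iterate_shift n)),
    ← H.integral_comp_iterate (continuous_indicator_one hT) n]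
  rfl

omit H in
theorem iterate_transfer_cyl {n : ℕ} (w : Fin n → A) (x : X A) :
    (transfer φ)^[n] ((cyl A w).indicator (fun _ => 1)) x =
      Real.exp (birkhoffSum (shift A) φ n (wcat w x)) := by
  classical
  rw [iterate_transfer_apply, Finset.sum_eq_single w]
  · simp [indicator_of_mem (wcat_mem_cyl w x)]
  · intro w' _ hne
    have : wcat w' x ∉ cyl A w := by
      intro h
      exact hne (((mem_cyl_iff w' _).1 (wcat_mem_cyl w' x)).symm.trans ((mem_cyl_iff w _).1 h))
    simp [indicator_of_notMem this]
  · simp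

omit H in
theorem iterate_transfer_box (n : ℕ) (z x : X A) :
    (transfer φ)^[n] ((box n z).indicator (fun _ => 1)) x =
      Real.exp (birkhoffSum (shift A) φ n (wcat (fun i : Fin n => z i) x)) := by
  rw [← cyl_restrict, iterate_transfer_cyl]

omit H in
theorem wcat_restrict_apply {n : ℕ} (z x : X A) {i : ℕ} (hi : i < n) :
    wcat (fun i : Fin n => z i) x i = z i := wcat_of_lt _ _ hi

theorem real_box_eq (n : ℕ) (z : X A) :
    μ.real (box n z) =
      ∫ x, Real.exp (birkhoffSum (shift A) φ n (wcat (fun i : Fin n => z i) x)) ∂μ := by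
  rw [← integral_indicator_clopen (isClopen_box n z),
    ← H.integral_iterate_transfer (continuous_indicator_one (isClopen_box n z)) n]
  simp_rw [iterate_transfer_box]

theorem integrable_exp_wcat (n : ℕ) (z : X A) : Integrable (fun x =>
    Real.exp (birkhoffSum (shift A) φ n (wcat (fun i : Fin n => z i) x))) μ :=
  H.integrable (Real.continuous_exp.comp
    ((continuous_birkhoffSum H.cont n).comp (continuous_wcat _)))

theorem real_box_le (n : ℕ) (z : X A) :
    μ.real (box n z) ≤ Real.exp (tail φ 0) * Real.exp (birkhoffSum (shift A) φ n z) := by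
  have := H.isProb
  rw [H.real_box_eq]
  refine (integral_mono (H.integrable_exp_wcat n z) (integrable_const
    (Real.exp (tail φ 0) * Real.exp (birkhoffSum (shift A) φ n z))) fun x => ?_).trans ?_
  · rw [← Real.exp_add]
    refine Real.exp_le_exp.2 ?_
    rw [add_comm]
    exact H.birkhoffSum_le_add fun i hi => wcat_restrict_apply z x hi
  · simp

theorem le_real_box (n : ℕ) (z : X A) :
    Real.exp (-tail φ 0) * Real.exp (birkhoffSum (shift A) φ n z) ≤ μ.real (box n z) := by
  have := H.isProb
  rw [H.real_box_eq]
  refine le_trans ?_ (integral_mono (integrable_const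
    (Real.exp (-tail φ 0) * Real.exp (birkhoffSum (shift A) φ n z)))
    (H.integrable_exp_wcat n z) fun x => ?_)
  · simp
  · rw [← Real.exp_add]
    refine Real.exp_le_exp.2 ?_
    have := H.birkhoffSum_le_add (n := n) (x := z) (y := wcat (fun i : Fin n => z i) x)
      fun i hi => (wcat_restrict_apply z x hi).symm
    linarith

theorem real_box_pos (n : ℕ) (z : X A) : 0 < μ.real (box n z) :=
  lt_of_lt_of_le (by positivity) (H.le_real_box n z)

theorem iterate_transfer_box_le (n : ℕ) (z x : X A) :
    (transfer φ)^[n] ((box n z).indicator (fun _ => 1)) x ≤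
      Real.exp (tail φ 0) * μ.real (box n z) := by
  have := H.isProb
  rw [iterate_transfer_box, H.real_box_eq, ← integral_const_mul]
  refine le_trans ?_ (integral_mono (integrable_const
    (Real.exp (birkhoffSum (shift A) φ n (wcat (fun i : Fin n => z i) x))))
    ((H.integrable_exp_wcat n z).const_mul _) fun y => ?_)
  · simp
  · rw [← Real.exp_add]
    refine Real.exp_le_exp.2 ?_
    rw [add_comm]
    exact H.birkhoffSum_le_add fun i hi =>
      (wcat_restrict_apply z x hi).trans (wcat_restrict_apply z y hi).symm

theorem le_iterate_transfer_box (n : ℕ) (z x : X A) :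
    Real.exp (-tail φ 0) * μ.real (box n z) ≤
      (transfer φ)^[n] ((box n z).indicator (fun _ => 1)) x := by
  have := H.isProb
  rw [iterate_transfer_box, H.real_box_eq, ← integral_const_mul]
  refine le_trans (integral_mono ((H.integrable_exp_wcat n z).const_mul _) (integrable_const
    (Real.exp (birkhoffSum (shift A) φ n (wcat (fun i : Fin n => z i) x)))) fun y => ?_) ?_
  · rw [← Real.exp_add]
    refine Real.exp_le_exp.2 ?_
    have := H.birkhoffSum_le_add (n := n) (x := wcat (fun i : Fin n => z i) y)
      (y := wcat (fun i : Fin n => z i) x)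
      fun i hi => (wcat_restrict_apply z y hi).trans (wcat_restrict_apply z x hi).symm
    linarith
  · simp

theorem integral_box_mul_comp_le (n : ℕ) (z : X A) {F : X A → ℝ} (hF : Continuous F)
    (hF0 : ∀ x, 0 ≤ F x) :
    ∫ x, (box n z).indicator (fun _ => 1) x * F ((shift A)^[n] x) ∂μ ≤
      Real.exp (tail φ 0) * μ.real (box n z) * ∫ x, F x ∂μ := by
  have hc := continuous_indicator_one (isClopen_box n z)
  rw [H.integral_mul_comp hc hF, ← integral_const_mul]
  exact integral_mono (H.integrable ((continuous_iterate_transfer H.cont hc n).mul hF))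
    (H.integrable (continuous_const.mul hF))
    fun x => mul_le_mul_of_nonneg_right (H.iterate_transfer_box_le n z x) (hF0 x)

theorem le_integral_box_mul_comp (n : ℕ) (z : X A) {F : X A → ℝ} (hF : Continuous F)
    (hF0 : ∀ x, 0 ≤ F x) :
    Real.exp (-tail φ 0) * μ.real (box n z) * ∫ x, F x ∂μ ≤
    ∫ x, (box n z).indicator (fun _ => 1) x * F ((shift A)^[n] x) ∂μ := by
  have hc := continuous_indicator_one (isClopen_box n z)
  rw [H.integral_mul_comp hc hF, ← integral_const_mul]
  exact integral_mono (H.integrable (continuous_const.mul hF))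
    (H.integrable ((continuous_iterate_transfer H.cont hc n).mul hF))
    fun x => mul_le_mul_of_nonneg_right (H.le_iterate_transfer_box n z x) (hF0 x)

omit H in
theorem integral_box_mul_indicator (n : ℕ) (z : X A) {T : Set (X A)} (hT : IsClopen T) :
    ∫ x, (box n z).indicator (fun _ => 1) x *
      T.indicator (fun _ => (1 : ℝ)) ((shift A)^[n] x) ∂μ =
      μ.real (box n z ∩ (shift A)^[n] ⁻¹' T) := by
  rw [← integral_indicator_clopen
    ((isClopen_box n z).inter (hT.preimage (continuous_iterate_shift n)))]
  congr 1
  ext x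
  by_cases h1 : x ∈ box n z <;> by_cases h2 : (shift A)^[n] x ∈ T <;> simp [h1, h2]

theorem real_box_inter_le (n : ℕ) (z : X A) {T : Set (X A)} (hT : IsClopen T) :
    μ.real (box n z ∩ (shift A)^[n] ⁻¹' T) ≤
      Real.exp (tail φ 0) * μ.real (box n z) * μ.real T := by
  rw [← integral_box_mul_indicator n z hT, ← integral_indicator_clopen hT]
  exact H.integral_box_mul_comp_le n z (continuous_indicator_one hT)
    fun x => indicator_nonneg (fun _ _ => zero_le_one) x

theorem le_real_box_inter (n : ℕ) (z : X A) {T : Set (X A)} (hT : IsClopen T) :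
    Real.exp (-tail φ 0) * μ.real (box n z) * μ.real T ≤
      μ.real (box n z ∩ (shift A)^[n] ⁻¹' T) := by
  rw [← integral_box_mul_indicator n z hT, ← integral_indicator_clopen hT]
  exact H.le_integral_box_mul_comp n z (continuous_indicator_one hT)
    fun x => indicator_nonneg (fun _ _ => zero_le_one) x

end Equilibrium
end Gibbs

section Sums
variable {A}

/-- The partition sum `∑_w μ(w)^s` over words of length `n`. -/
noncomputable def wordSum (μ : Measure (X A)) (s : ℝ) (n : ℕ) : ℝ :=
  ∑ w : Fin n → A, μ.real (cyl A w) ^ s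

/-- The sequence obtained by repeating the first `n` symbols of `z`. -/
def periodize (n : ℕ) (z : X A) : X A := fun i => z (i % n)

theorem periodize_of_lt {n i : ℕ} (z : X A) (hi : i < n) : periodize n z i = z i := by
  rw [periodize, Nat.mod_eq_of_lt hi]

theorem iterate_shift_periodize (n : ℕ) (z : X A) :
    (shift A)^[n] (periodize n z) = periodize n z := by
  ext i; rw [iterate_shift_apply, periodize, periodize, Nat.add_mod_right]

theorem cyl_append {n k : ℕ} (u : Fin n → A) (v : Fin k → A) :
    cyl A (Fin.append u v) = cyl A u ∩ (shift A)^[n] ⁻¹' cyl A v := by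
  ext x
  constructor
  · intro h
    refine ⟨fun i => ?_, fun i => ?_⟩
    · simpa using h (Fin.castAdd k i)
    · rw [iterate_shift_apply]
      simpa [add_comm] using h (Fin.natAdd n i)
  · rintro ⟨h1, h2⟩ i
    refine Fin.addCases (fun i => ?_) (fun i => ?_) i
    · simpa using h1 i
    · have := h2 i
      rw [iterate_shift_apply] at this
      simpa [add_comm] using this

theorem sum_append {n k : ℕ} (f : (Fin (n + k) → A) → ℝ) :
    ∑ w, f w = ∑ u : Fin n → A, ∑ v : Fin k → A, f (Fin.append u v) := by
  rw [← (Fin.appendEquiv n k).sum_comp, Fintype.sum_prod_type]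
  rfl

theorem exp_neg_mul_rpow_le {D a b s : ℝ} (ha : 0 < a) (hb : 0 < b)
    (h1 : Real.exp (-D) * a ≤ b) (h2 : b ≤ Real.exp D * a) :
    Real.exp (-(|s| * D)) * a ^ s ≤ b ^ s ∧ b ^ s ≤ Real.exp (|s| * D) * a ^ s := by
  have h1' : -D + Real.log a ≤ Real.log b := by
    have := Real.log_le_log (by positivity) h1
    rwa [Real.log_mul (by positivity) ha.ne', Real.log_exp] at this
  have h2' : Real.log b ≤ D + Real.log a := by
    have := Real.log_le_log hb h2
    rwa [Real.log_mul (by positivity) ha.ne', Real.log_exp] at this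
  have h3 : |s * (Real.log b - Real.log a)| ≤ |s| * D := by
    rw [abs_mul]
    exact mul_le_mul_of_nonneg_left (abs_le.2 ⟨by linarith, by linarith⟩) (abs_nonneg s)
  rw [abs_le] at h3
  rw [Real.rpow_def_of_pos ha, Real.rpow_def_of_pos hb, ← Real.exp_add, ← Real.exp_add]
  constructor <;> refine Real.exp_le_exp.2 ?_ <;> nlinarith

theorem measurable_shift : Measurable (shift A) := continuous_shift.measurable

/-- A finite measure is distributed over the cylinders of a given length. -/
theorem sum_real_cyl_inter (η : Measure (X A)) [IsFiniteMeasure η] [Nonempty A] (n : ℕ)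
    {S : Set (X A)} (hS : MeasurableSet S) :
    ∑ w : Fin n → A, η.real (cyl A w ∩ S) = η.real S := by
  rw [← measureReal_iUnion_fintype]
  · congr 1
    ext x
    simp only [mem_iUnion, mem_inter_iff, exists_and_right, and_iff_right_iff_imp]
    exact fun _ => ⟨fun i => x i, fun _ => rfl⟩
  · intro w w' hne
    refine Set.disjoint_left.2 fun x hx hx' => hne ?_
    rw [← (mem_cyl_iff w x).1 hx.1, (mem_cyl_iff w' x).1 hx'.1]
  · exact fun w => (isClopen_cyl w).isOpen.measurableSet.inter hS

theorem sum_real_cyl (η : Measure (X A)) [IsProbabilityMeasure η] [Nonempty A] (n : ℕ) :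
    ∑ w : Fin n → A, η.real (cyl A w) = 1 := by
  have := sum_real_cyl_inter η n MeasurableSet.univ
  simpa using this

section Invariant

theorem InvProb.measurePreserving {η : Measure (X A)} (hη : InvProb A η) :
    MeasurePreserving (shift A) η η := ⟨measurable_shift, hη.2⟩

theorem InvProb.integral_comp_iterate {η : Measure (X A)} (hη : InvProb A η) {f : X A → ℝ}
    (hf : Continuous f) (n : ℕ) : ∫ x, f ((shift A)^[n] x) ∂η = ∫ x, f x ∂η := by
  have h := hη.measurePreserving.iterate n
  rw [← integral_map h.measurable.aemeasurable
    (hf.aestronglyMeasurable), h.map_eq]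

theorem InvProb.integral_birkhoffSum {φ : X A → ℝ} {η : Measure (X A)} (hη : InvProb A η)
    (hφ : Continuous φ) (n : ℕ) :
    ∫ x, birkhoffSum (shift A) φ n x ∂η = n * ∫ x, φ x ∂η := by
  have := hη.1
  simp only [birkhoffSum]
  rw [integral_finsetSum]
  · simp [hη.integral_comp_iterate hφ]
  · intro i _
    obtain ⟨B, hB⟩ := (isCompact_univ (X := X A)).exists_bound_of_continuousOn
      (hφ.comp (continuous_iterate_shift i)).continuousOn
    exact Integrable.of_bound (hφ.comp (continuous_iterate_shift i)).aestronglyMeasurable B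
      (ae_of_all _ fun x => hB x (mem_univ x))

/-- The uniform measure on a periodic orbit. -/
noncomputable def orbitMeasure (n : ℕ) (x : X A) : Measure (X A) :=
  ∑ k ∈ Finset.range n, ENNReal.ofReal ((n : ℝ)⁻¹) • Measure.dirac ((shift A)^[k] x)

theorem invProb_orbitMeasure {n : ℕ} (hn : n ≠ 0) {x : X A} (hx : (shift A)^[n] x = x) :
    InvProb A (orbitMeasure n x) := by
  constructor
  · constructor
    have h0 : (0 : ℝ) < n := by positivity
    simp only [orbitMeasure, Measure.coe_finsetSum, Finset.sum_apply, Measure.smul_apply,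
      measure_univ, smul_eq_mul, mul_one, Finset.sum_const, Finset.card_range, nsmul_eq_mul]
    rw [ENNReal.ofReal_inv_of_pos h0, ENNReal.ofReal_natCast, ENNReal.mul_inv_cancel]
    · exact_mod_cast hn
    · simp
  · rw [orbitMeasure, ← Measure.mapₗ_apply_of_measurable measurable_shift, map_sum]
    simp only [Measure.mapₗ_apply_of_measurable measurable_shift, Measure.map_smul,
      Measure.map_dirac' measurable_shift, ← Function.iterate_succ_apply' (shift A)]
    obtain ⟨m, rfl⟩ := Nat.exists_eq_succ_of_ne_zero hn
    rw [Finset.sum_range_succ, Finset.sum_range_succ']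
    simp only [Nat.succ_eq_add_one] at hx ⊢
    rw [hx]
    rfl

theorem integral_orbitMeasure (φ : X A → ℝ) (n : ℕ) (x : X A) :
    ∫ y, φ y ∂(orbitMeasure n x) = (n : ℝ)⁻¹ * birkhoffSum (shift A) φ n x := by
  rw [orbitMeasure, integral_finsetSum_measure]
  · simp [birkhoffSum, Finset.mul_sum, integral_smul_measure, integral_dirac]
  · intro i _
    exact Integrable.smul_measure (integrable_dirac (by simp)) ENNReal.ofReal_ne_top

end Invariant

namespace Equilibrium

variable {φ : X A → ℝ} {μ : Measure (X A)} (H : Equilibrium φ μ)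
include H

theorem real_cyl_pos {n : ℕ} (w : Fin n → A) : 0 < μ.real (cyl A w) := by
  obtain ⟨a⟩ := H.nonempty
  rw [cyl_eq_box w fun _ => a]; exact H.real_box_pos _ _

theorem real_cyl_le_one {n : ℕ} (w : Fin n → A) : μ.real (cyl A w) ≤ 1 := by
  have := H.isProb
  exact measureReal_le_one

theorem real_cyl_append_le {n k : ℕ} (u : Fin n → A) (v : Fin k → A) :
    μ.real (cyl A (Fin.append u v)) ≤
      Real.exp (tail φ 0) * (μ.real (cyl A u) * μ.real (cyl A v)) := by
  have := H.nonempty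
  rw [cyl_append, cyl_eq_box u fun _ => Classical.arbitrary A, ← mul_assoc]
  exact H.real_box_inter_le n _ (isClopen_cyl v)

theorem le_real_cyl_append {n k : ℕ} (u : Fin n → A) (v : Fin k → A) :
    Real.exp (-tail φ 0) * (μ.real (cyl A u) * μ.real (cyl A v)) ≤
      μ.real (cyl A (Fin.append u v)) := by
  have := H.nonempty
  rw [cyl_append, cyl_eq_box u fun _ => Classical.arbitrary A, ← mul_assoc]
  exact H.le_real_box_inter n _ (isClopen_cyl v)

theorem rpow_cyl_append (s : ℝ) {n k : ℕ} (u : Fin n → A) (v : Fin k → A) :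
    Real.exp (-(|s| * tail φ 0)) * (μ.real (cyl A u) ^ s * μ.real (cyl A v) ^ s) ≤
      μ.real (cyl A (Fin.append u v)) ^ s ∧
    μ.real (cyl A (Fin.append u v)) ^ s ≤
      Real.exp (|s| * tail φ 0) * (μ.real (cyl A u) ^ s * μ.real (cyl A v) ^ s) := by
  rw [← Real.mul_rpow (H.real_cyl_pos u).le (H.real_cyl_pos v).le]
  exact exp_neg_mul_rpow_le (mul_pos (H.real_cyl_pos u) (H.real_cyl_pos v)) (H.real_cyl_pos _)
    (H.le_real_cyl_append u v) (H.real_cyl_append_le u v)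

theorem wordSum_pos (s : ℝ) (n : ℕ) : 0 < wordSum μ s n := by
  have := H.nonempty
  exact Finset.sum_pos (fun w _ => Real.rpow_pos_of_pos (H.real_cyl_pos w) s)
    Finset.univ_nonempty

theorem wordSum_add_le (s : ℝ) (n k : ℕ) :
    wordSum μ s (n + k) ≤ Real.exp (|s| * tail φ 0) * (wordSum μ s n * wordSum μ s k) := by
  rw [wordSum, sum_append, wordSum, wordSum, Finset.sum_mul_sum, Finset.mul_sum]
  refine Finset.sum_le_sum fun u _ => ?_
  rw [Finset.mul_sum]
  exact Finset.sum_le_sum fun v _ => (H.rpow_cyl_append s u v).2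

theorem le_wordSum_add (s : ℝ) (n k : ℕ) :
    Real.exp (-(|s| * tail φ 0)) * (wordSum μ s n * wordSum μ s k) ≤ wordSum μ s (n + k) := by
  rw [wordSum, wordSum, wordSum, sum_append, Finset.sum_mul_sum, Finset.mul_sum]
  refine Finset.sum_le_sum fun u _ => ?_
  rw [Finset.mul_sum]
  exact Finset.sum_le_sum fun v _ => (H.rpow_cyl_append s u v).1

theorem wordSum_one (n : ℕ) : wordSum μ 1 n = 1 := by
  have := H.isProb
  have := H.nonempty
  simpa [wordSum] using sum_real_cyl μ n

theorem abs_log_real_cyl_le {B : ℝ} (hB : ∀ x, |φ x| ≤ B) {n : ℕ} (w : Fin n → A) :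
    |Real.log (μ.real (cyl A w))| ≤ tail φ 0 + n * B := by
  obtain ⟨a⟩ := H.nonempty
  have h0 := Real.log_nonpos measureReal_nonneg (H.real_cyl_le_one w)
  rw [abs_of_nonpos h0]
  have h1 := H.le_real_box n (wcat w fun _ => a)
  rw [← cyl_eq_box] at h1
  have h2 := Real.log_le_log (by positivity) h1
  rw [← Real.exp_add, Real.log_exp] at h2
  have h3 : -(n * B) ≤ birkhoffSum (shift A) φ n (wcat w fun _ => a) := by
    rw [birkhoffSum]
    have := Finset.card_nsmul_le_sum (Finset.range n)
      (fun k => φ ((shift A)^[k] (wcat w fun _ => a))) (-B) fun i _ => (abs_le.1 (hB _)).1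
    simpa using this
  linarith

theorem exists_tendsto_wordSum (s : ℝ) :
    ∃ L : ℝ, Tendsto (fun n : ℕ => Real.log (wordSum μ s n) / n) atTop (𝓝 L) ∧
      ∀ n : ℕ, n * L ≤ Real.log (wordSum μ s n) + |s| * tail φ 0 := by
  obtain ⟨B, hB0, hB⟩ := H.exists_bound
  have := H.nonempty
  set c := |s| * tail φ 0 with hc
  have hc0 : 0 ≤ c := mul_nonneg (abs_nonneg _) (H.tail_nonneg 0)
  have hsub : Subadditive fun n => Real.log (wordSum μ s n) + c := by
    intro n k
    have h := Real.log_le_log (H.wordSum_pos s _) (H.wordSum_add_le s n k)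
    rw [Real.log_mul (Real.exp_pos _).ne'
      (mul_pos (H.wordSum_pos s n) (H.wordSum_pos s k)).ne', Real.log_exp,
      Real.log_mul (H.wordSum_pos s n).ne' (H.wordSum_pos s k).ne'] at h
    linarith
  have hbdd : BddBelow (range fun n : ℕ => (Real.log (wordSum μ s n) + c) / n) := by
    refine ⟨-(|s| * B), ?_⟩
    rintro _ ⟨n, rfl⟩
    rcases Nat.eq_zero_or_pos n with rfl | hn
    · simp; positivity
    have hn' : (0 : ℝ) < n := by exact_mod_cast hn
    have w : Fin n → A := Classical.arbitrary _
    have h1 : μ.real (cyl A w) ^ s ≤ wordSum μ s n :=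
      Finset.single_le_sum (f := fun w : Fin n → A => μ.real (cyl A w) ^ s)
        (fun w _ => Real.rpow_nonneg measureReal_nonneg s) (Finset.mem_univ w)
    have h2 := Real.log_le_log (Real.rpow_pos_of_pos (H.real_cyl_pos w) s) h1
    rw [Real.log_rpow (H.real_cyl_pos w)] at h2
    have h3 : |s * Real.log (μ.real (cyl A w))| ≤ |s| * (tail φ 0 + n * B) := by
      rw [abs_mul]
      exact mul_le_mul_of_nonneg_left (H.abs_log_real_cyl_le hB w) (abs_nonneg s)
    have h4 := (abs_le.1 h3).1
    rw [le_div_iff₀ hn']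
    nlinarith
  refine ⟨hsub.lim, ?_, fun n => ?_⟩
  swap
  · rcases Nat.eq_zero_or_pos n with rfl | hn
    · have h0 : ∀ w : Fin 0 → A, cyl A w = univ := fun w =>
        eq_univ_of_forall fun x i => i.elim0
      have := H.isProb
      simpa [wordSum, h0] using hc0
    have hn' : (0 : ℝ) < n := by exact_mod_cast hn
    have h := hsub.lim_le_div hbdd hn.ne'
    rwa [le_div_iff₀' hn'] at h
  have h1 := (hsub.tendsto_lim hbdd).sub
    (tendsto_const_div_atTop_nhds_zero_nat c)
  rw [sub_zero] at h1
  refine h1.congr fun n => ?_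
  rw [← sub_div, add_sub_cancel_right]

theorem integrable_of_isFiniteMeasure {f : X A → ℝ} (hf : Continuous f) (η : Measure (X A))
    [IsFiniteMeasure η] : Integrable f η := by
  obtain ⟨B, hB⟩ := (isCompact_univ (X := X A)).exists_bound_of_continuousOn hf.continuousOn
  exact Integrable.of_bound hf.aestronglyMeasurable B (ae_of_all _ fun x => hB x (mem_univ x))

theorem integral_le_of_le {f : X A → ℝ} (hf : Continuous f) {c : ℝ} (h : ∀ x, f x ≤ c)
    (η : Measure (X A)) [IsProbabilityMeasure η] : ∫ x, f x ∂η ≤ c := by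
  refine (integral_mono (H.integrable_of_isFiniteMeasure hf η) (integrable_const c) h).trans ?_
  simp

theorem exists_invProb : ∃ η : Measure (X A), InvProb A η := by
  obtain ⟨a⟩ := H.nonempty
  exact ⟨_, invProb_orbitMeasure one_ne_zero (x := fun _ => a) rfl⟩

theorem integral_le_supInt {η : Measure (X A)} (hη : InvProb A η) :
    ∫ x, φ x ∂η ≤ supInt A φ := by
  obtain ⟨B, hB0, hB⟩ := H.exists_bound
  refine le_csSup ⟨B, ?_⟩ ⟨η, hη, rfl⟩
  rintro r ⟨η', hη', rfl⟩
  have := hη'.1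
  exact H.integral_le_of_le H.cont (fun x => (abs_le.1 (hB x)).2) η'

theorem supInt_le {c : ℝ} (h : ∀ η : Measure (X A), InvProb A η → ∫ x, φ x ∂η ≤ c) :
    supInt A φ ≤ c := by
  obtain ⟨η, hη⟩ := H.exists_invProb
  refine csSup_le ⟨_, η, hη, rfl⟩ ?_
  rintro r ⟨η', hη', rfl⟩
  exact h η' hη'

theorem birkhoffSum_periodic_le {n : ℕ} {x : X A} (hx : (shift A)^[n] x = x) :
    birkhoffSum (shift A) φ n x ≤ n * supInt A φ := by
  rcases Nat.eq_zero_or_pos n with rfl | hn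
  · simp
  have h := H.integral_le_supInt (invProb_orbitMeasure hn.ne' hx)
  have hn' : (0 : ℝ) < n := by exact_mod_cast hn
  rw [integral_orbitMeasure φ, inv_mul_le_iff₀ hn'] at h
  exact h

theorem birkhoffSum_le (n : ℕ) (x : X A) :
    birkhoffSum (shift A) φ n x ≤ n * supInt A φ + tail φ 0 :=
  (H.birkhoffSum_le_add fun _ hi => (periodize_of_lt x hi).symm).trans
    (add_le_add_left (H.birkhoffSum_periodic_le (iterate_shift_periodize n x)) _)

theorem exists_le_birkhoffSum (n : ℕ) :
    ∃ x, n * supInt A φ ≤ birkhoffSum (shift A) φ n x := by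
  have := H.nonempty
  obtain ⟨x, -, hx⟩ := (isCompact_univ (X := X A)).exists_isMaxOn univ_nonempty
    (continuous_birkhoffSum H.cont n).continuousOn
  refine ⟨x, ?_⟩
  rcases Nat.eq_zero_or_pos n with rfl | hn
  · simp
  have hn' : (0 : ℝ) < n := by exact_mod_cast hn
  rw [← le_div_iff₀' hn']
  refine H.supInt_le fun η hη => ?_
  rw [le_div_iff₀' hn', ← hη.integral_birkhoffSum H.cont]
  have := hη.1
  exact H.integral_le_of_le (continuous_birkhoffSum H.cont n) (fun y => hx (mem_univ y)) η

theorem real_box_le_exp (n : ℕ) (z : X A) :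
    μ.real (box n z) ≤ Real.exp (2 * tail φ 0 + n * supInt A φ) := by
  refine (H.real_box_le n z).trans ?_
  rw [← Real.exp_add]
  refine Real.exp_le_exp.2 ?_
  linarith [H.birkhoffSum_le n z]

theorem exists_le_real_box (n : ℕ) :
    ∃ z, Real.exp (-tail φ 0 + n * supInt A φ) ≤ μ.real (box n z) := by
  obtain ⟨z, hz⟩ := H.exists_le_birkhoffSum n
  refine ⟨z, le_trans ?_ (H.le_real_box n z)⟩
  rw [← Real.exp_add]
  exact Real.exp_le_exp.2 (by linarith)

theorem tendsto_gammaSeq : Tendsto (gammaSeq A μ) atTop (𝓝 (supInt A φ)) := by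
  have := H.nonempty
  have hbdd : ∀ n : ℕ, BddAbove (range fun w : Fin n → A => (μ (cyl A w)).toReal) :=
    fun n => finite_range _ |>.bddAbove
  have hlow : ∀ n : ℕ, Real.exp (-tail φ 0 + n * supInt A φ) ≤
      ⨆ w : Fin n → A, (μ (cyl A w)).toReal := by
    intro n
    obtain ⟨z, hz⟩ := H.exists_le_real_box n
    rw [← cyl_restrict] at hz
    exact hz.trans (le_ciSup (hbdd n) _)
  have hup : ∀ n : ℕ, ⨆ w : Fin n → A, (μ (cyl A w)).toReal ≤
      Real.exp (2 * tail φ 0 + n * supInt A φ) := by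
    intro n
    refine ciSup_le fun w => ?_
    have h := H.real_box_le_exp n (wcat w fun _ => Classical.arbitrary A)
    rwa [← cyl_eq_box] at h
  have hlim : ∀ c : ℝ, Tendsto (fun n : ℕ => c / n + supInt A φ) atTop (𝓝 (supInt A φ)) := by
    intro c
    simpa using (tendsto_const_div_atTop_nhds_zero_nat c).add_const (supInt A φ)
  refine tendsto_of_tendsto_of_tendsto_of_le_of_le' (hlim (-tail φ 0)) (hlim (2 * tail φ 0)) ?_ ?_
  · filter_upwards [eventually_gt_atTop 0] with n hn
    have hn' : (0 : ℝ) < n := by exact_mod_cast hn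
    have h := Real.log_le_log (Real.exp_pos _) (hlow n)
    rw [Real.log_exp] at h
    rw [gammaSeq, one_div, ← div_eq_inv_mul, le_div_iff₀ hn', add_mul, div_mul_cancel₀ _ hn'.ne']
    linarith
  · filter_upwards [eventually_gt_atTop 0] with n hn
    have hn' : (0 : ℝ) < n := by exact_mod_cast hn
    have h := Real.log_le_log ((Real.exp_pos _).trans_le (hlow n)) (hup n)
    rw [Real.log_exp] at h
    rw [gammaSeq, one_div, ← div_eq_inv_mul, div_le_iff₀ hn', add_mul, div_mul_cancel₀ _ hn'.ne']
    linarith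

end Equilibrium
end Sums

section Pressure
variable {A}

/-- Asymptotically invariant probability measures accumulate at invariant ones. -/
theorem exists_invProb_limit (κ : ℕ → Measure (X A)) (hκ : ∀ n, IsProbabilityMeasure (κ n))
    (hinv : ∀ f : X A → ℝ, Continuous f →
      Tendsto (fun n => ∫ x, f (shift A x) ∂(κ n) - ∫ x, f x ∂(κ n)) atTop (𝓝 0)) :
    ∃ η : Measure (X A), InvProb A η ∧ ∀ S : Set (X A), IsClopen S → ∀ c : ℝ,
      (∀ᶠ n in atTop, (κ n).real S ≤ c) → η.real S ≤ c := by
  let p : ℕ → ProbabilityMeasure (X A) := fun n => ⟨κ n, hκ n⟩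
  obtain ⟨η, -, hη⟩ := isCompact_univ.ultrafilter_le_nhds ((hyperfilter ℕ).map p) (by simp)
  have hlim : Tendsto p (hyperfilter ℕ) (𝓝 η) := hη
  have hle : (hyperfilter ℕ : Filter ℕ) ≤ atTop := Nat.hyperfilter_le_atTop
  have h_intg : ∀ f : X A → ℝ, Continuous f →
      Tendsto (fun n => ∫ x, f x ∂(κ n)) (hyperfilter ℕ) (𝓝 (∫ x, f x ∂(η : Measure (X A)))) := by
    intro f hf
    exact ProbabilityMeasure.tendsto_iff_forall_integral_tendsto.1 hlim
      (BoundedContinuousFunction.mkOfCompact ⟨f, hf⟩)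
  refine ⟨η, ⟨inferInstance, ?_⟩, ?_⟩
  · have : IsProbabilityMeasure (Measure.map (shift A) (η : Measure (X A))) :=
      Measure.isProbabilityMeasure_map measurable_shift.aemeasurable
    refine ext_of_forall_integral_eq_of_IsFiniteMeasure fun f => ?_
    rw [integral_map measurable_shift.aemeasurable f.continuous.aestronglyMeasurable]
    have h1 := (h_intg _ (f.continuous.comp continuous_shift)).sub (h_intg _ f.continuous)
    have h2 := tendsto_nhds_unique h1 ((hinv f f.continuous).mono_left hle)
    exact sub_eq_zero.1 h2
  · intro S hS c hc
    have h1 := h_intg _ (continuous_indicator_one hS)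
    simp_rw [Equilibrium.integral_indicator_clopen hS] at h1
    exact le_of_tendsto h1 (hle hc)

/-- Integral of a function of the first `n` symbols. -/
theorem integral_word (η : Measure (X A)) [IsProbabilityMeasure η] [Nonempty A] (n : ℕ)
    (g : (Fin n → A) → ℝ) :
    ∫ x, g (fun i : Fin n => x i) ∂η = ∑ w : Fin n → A, η.real (cyl A w) * g w := by
  classical
  have h : ∀ x : X A, g (fun i : Fin n => x i) =
      ∑ w : Fin n → A, (cyl A w).indicator (fun _ => (1 : ℝ)) x * g w := by
    intro x
    rw [Finset.sum_eq_single fun i : Fin n => x i]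
    · rw [indicator_of_mem ((mem_cyl_iff _ _).2 rfl), one_mul]
    · intro w _ hw
      rw [indicator_of_notMem fun h => hw ((mem_cyl_iff w x).1 h).symm, zero_mul]
    · simp
  simp_rw [h]
  rw [integral_finsetSum]
  · refine Finset.sum_congr rfl fun w _ => ?_
    rw [integral_mul_const, Equilibrium.integral_indicator_clopen (isClopen_cyl w)]
  · intro w _
    exact ((integrable_const (1 : ℝ)).indicator
      (isClopen_cyl w).isOpen.measurableSet).mul_const _

namespace Equilibrium

variable {φ : X A → ℝ} {μ : Measure (X A)} (H : Equilibrium φ μ)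
include H

theorem abs_birkhoffSum_sub_log_le (n : ℕ) (x : X A) :
    |birkhoffSum (shift A) φ n x - Real.log (μ.real (cyl A fun i : Fin n => x i))| ≤
      tail φ 0 := by
  rw [cyl_restrict]
  have h1 := Real.log_le_log (H.real_box_pos n x) (H.real_box_le n x)
  have h2 := Real.log_le_log (by positivity) (H.le_real_box n x)
  rw [← Real.exp_add, Real.log_exp] at h1 h2
  rw [abs_le]
  constructor <;> linarith

theorem abs_integral_sub_sum_log_le {η : Measure (X A)} (hη : InvProb A η) (n : ℕ) :
    |n * ∫ x, φ x ∂η - ∑ w : Fin n → A, η.real (cyl A w) * Real.log (μ.real (cyl A w))| ≤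
      tail φ 0 := by
  have := hη.1
  have := H.nonempty
  have hb := H.integrable_of_isFiniteMeasure (continuous_birkhoffSum H.cont n) η
  have hg : Integrable (fun x : X A => Real.log (μ.real (cyl A fun i : Fin n => x i))) η := by
    have hm : Measurable fun x : X A => Real.log (μ.real (cyl A fun i : Fin n => x i)) :=
      (Measurable.of_discrete (f := fun w : Fin n → A => Real.log (μ.real (cyl A w)))).comp
        (measurable_pi_lambda _ fun i => measurable_pi_apply (i : ℕ))
    obtain ⟨B, -, hB⟩ := H.exists_bound
    exact Integrable.of_bound hm.aestronglyMeasurable _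
      (ae_of_all _ fun x => H.abs_log_real_cyl_le hB _)
  rw [← integral_word η n fun w => Real.log (μ.real (cyl A w)), ← hη.integral_birkhoffSum H.cont,
    ← integral_sub hb hg]
  refine (norm_integral_le_of_norm_le_const (μ := η) (C := tail φ 0) (ae_of_all _ fun x => by
    rw [Real.norm_eq_abs]; exact H.abs_birkhoffSum_sub_log_le n x)).trans ?_
  simp

/-- Finite-volume Gibbs inequality. -/
theorem entSeq_add_le {η : Measure (X A)} (hη : InvProb A η) (s : ℝ) {n : ℕ} (hn : 0 < n) :
    entSeq A η n + s * ∫ x, φ x ∂η ≤ (Real.log (wordSum μ s n) + |s| * tail φ 0) / n := by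
  have := hη.1
  have := H.nonempty
  have hn' : (0 : ℝ) < n := by exact_mod_cast hn
  have hZ := H.wordSum_pos s n
  have h1 := H.abs_integral_sub_sum_log_le hη n
  have h2 : s * (n * ∫ x, φ x ∂η) -
      s * ∑ w : Fin n → A, η.real (cyl A w) * Real.log (μ.real (cyl A w)) ≤ |s| * tail φ 0 := by
    rw [← mul_sub]
    refine (le_abs_self _).trans ?_
    rw [abs_mul]
    exact mul_le_mul_of_nonneg_left h1 (abs_nonneg s)
  have h3 : ∀ w : Fin n → A, η.real (cyl A w) * (s * Real.log (μ.real (cyl A w))) -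
      η.real (cyl A w) * Real.log (η.real (cyl A w)) -
      η.real (cyl A w) * Real.log (wordSum μ s n) ≤
      μ.real (cyl A w) ^ s / wordSum μ s n - η.real (cyl A w) := by
    intro w
    have ht : 0 ≤ η.real (cyl A w) := measureReal_nonneg
    have ha := Real.rpow_pos_of_pos (H.real_cyl_pos w) s
    rcases ht.eq_or_lt with h | h
    · rw [← h]; simp; positivity
    have h4 := Real.log_le_sub_one_of_pos
      (x := μ.real (cyl A w) ^ s / wordSum μ s n / η.real (cyl A w)) (by positivity)
    rw [Real.log_div (by positivity) h.ne', Real.log_div ha.ne' hZ.ne',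
      Real.log_rpow (H.real_cyl_pos w)] at h4
    have h5 := mul_le_mul_of_nonneg_left h4 ht
    rw [mul_sub, mul_sub, mul_sub, mul_one, mul_div_cancel₀ _ h.ne'] at h5
    linarith
  have h6 := Finset.sum_le_sum fun w (_ : w ∈ Finset.univ) => h3 w
  rw [Finset.sum_sub_distrib, Finset.sum_sub_distrib, Finset.sum_sub_distrib, ← Finset.sum_mul,
    ← Finset.sum_div, sum_real_cyl η n, one_mul] at h6
  have h7 : (∑ w : Fin n → A, μ.real (cyl A w) ^ s) / wordSum μ s n = 1 := div_self hZ.ne'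
  have h8 : ∑ w : Fin n → A, η.real (cyl A w) * (s * Real.log (μ.real (cyl A w))) =
      s * ∑ w : Fin n → A, η.real (cyl A w) * Real.log (μ.real (cyl A w)) := by
    rw [Finset.mul_sum]; exact Finset.sum_congr rfl fun w _ => by ring
  rw [h7, h8] at h6
  rw [le_div_iff₀ hn', entSeq]
  have h9 : (-(1 / (n : ℝ)) * ∑ w : Fin n → A, (η (cyl A w)).toReal *
      Real.log (η (cyl A w)).toReal + s * ∫ x, φ x ∂η) * n =
      -(∑ w : Fin n → A, η.real (cyl A w) * Real.log (η.real (cyl A w))) +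
      s * (n * ∫ x, φ x ∂η) := by
    simp only [measureReal_def]
    field_simp
  rw [h9]
  linarith

theorem le_entSeq_add {η : Measure (X A)} (hη : InvProb A η) (s : ℝ) {n : ℕ} (hn : 0 < n) {c : ℝ}
    (hc : ∀ w : Fin n → A, η.real (cyl A w) ≤
      Real.exp c * μ.real (cyl A w) ^ s / wordSum μ s n) :
    (Real.log (wordSum μ s n) - (c + |s| * tail φ 0)) / n ≤
      entSeq A η n + s * ∫ x, φ x ∂η := by
  have := hη.1
  have := H.nonempty
  have hn' : (0 : ℝ) < n := by exact_mod_cast hn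
  have hZ := H.wordSum_pos s n
  have h1 := H.abs_integral_sub_sum_log_le hη n
  have h2 : -(|s| * tail φ 0) ≤ s * (n * ∫ x, φ x ∂η) -
      s * ∑ w : Fin n → A, η.real (cyl A w) * Real.log (μ.real (cyl A w)) := by
    rw [← mul_sub]
    refine le_trans (neg_le_neg ?_) (neg_abs_le _)
    rw [abs_mul]
    exact mul_le_mul_of_nonneg_left h1 (abs_nonneg s)
  have h3 : ∀ w : Fin n → A, η.real (cyl A w) * Real.log (η.real (cyl A w)) ≤
      η.real (cyl A w) * (c - Real.log (wordSum μ s n)) +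
      s * (η.real (cyl A w) * Real.log (μ.real (cyl A w))) := by
    intro w
    have ht : 0 ≤ η.real (cyl A w) := measureReal_nonneg
    have ha := Real.rpow_pos_of_pos (H.real_cyl_pos w) s
    rcases ht.eq_or_lt with h | h
    · rw [← h]; simp
    have h4 := Real.log_le_log h (hc w)
    rw [Real.log_div (by positivity) hZ.ne', Real.log_mul (by positivity) ha.ne', Real.log_exp,
      Real.log_rpow (H.real_cyl_pos w)] at h4
    have h5 := mul_le_mul_of_nonneg_left h4 ht
    linarith
  have h6 := Finset.sum_le_sum fun w (_ : w ∈ Finset.univ) => h3 w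
  rw [Finset.sum_add_distrib, ← Finset.sum_mul, ← Finset.mul_sum, sum_real_cyl η n, one_mul] at h6
  rw [div_le_iff₀ hn', entSeq]
  have h9 : (-(1 / (n : ℝ)) * ∑ w : Fin n → A, (η (cyl A w)).toReal *
      Real.log (η (cyl A w)).toReal + s * ∫ x, φ x ∂η) * n =
      -(∑ w : Fin n → A, η.real (cyl A w) * Real.log (η.real (cyl A w))) +
      s * (n * ∫ x, φ x ∂η) := by
    simp only [measureReal_def]
    field_simp
  rw [h9]
  linarith

end Equilibrium
end Pressure

section Variational
variable {A}

/-- Orbit averages of the probability on words of length `2 (N + 1)` with weights `μ(w)^s`. -/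
noncomputable def gibbsAverage (μ : Measure (X A)) (s : ℝ) (x : X A) (N : ℕ) : Measure (X A) :=
  ∑ j ∈ Finset.range (N + 1), ∑ w : Fin (2 * (N + 1)) → A,
    ENNReal.ofReal (((N : ℝ) + 1)⁻¹ * (μ.real (cyl A w) ^ s / wordSum μ s (2 * (N + 1)))) •
      Measure.dirac ((shift A)^[j] (wcat w x))

namespace Equilibrium

variable {φ : X A → ℝ} {μ : Measure (X A)} (H : Equilibrium φ μ)
include H

theorem integral_gibbsAverage (s : ℝ) (x : X A) (N : ℕ) (f : X A → ℝ) :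
    ∫ y, f y ∂(gibbsAverage μ s x N) =
      ∑ j ∈ Finset.range (N + 1), ((N : ℝ) + 1)⁻¹ * ∑ w : Fin (2 * (N + 1)) → A,
        μ.real (cyl A w) ^ s / wordSum μ s (2 * (N + 1)) * f ((shift A)^[j] (wcat w x)) := by
  have hi : ∀ (j : ℕ) (w : Fin (2 * (N + 1)) → A), Integrable f (ENNReal.ofReal
      (((N : ℝ) + 1)⁻¹ * (μ.real (cyl A w) ^ s / wordSum μ s (2 * (N + 1)))) •
      Measure.dirac ((shift A)^[j] (wcat w x))) := fun j w =>
    Integrable.smul_measure (integrable_dirac (by simp)) ENNReal.ofReal_ne_top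
  rw [gibbsAverage, integral_finsetSum_measure]
  · refine Finset.sum_congr rfl fun j _ => ?_
    rw [integral_finsetSum_measure fun w _ => hi j w, Finset.mul_sum]
    refine Finset.sum_congr rfl fun w _ => ?_
    have h1 := H.wordSum_pos s (2 * (N + 1))
    have h2 := Real.rpow_pos_of_pos (H.real_cyl_pos w) s
    rw [integral_smul_measure, integral_dirac, ENNReal.toReal_ofReal (by positivity), smul_eq_mul,
      mul_assoc]
  · intro j _
    exact integrable_finsetSum_measure.2 fun w _ => hi j w

theorem sum_rpow_div_wordSum (s : ℝ) (n : ℕ) :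
    ∑ w : Fin n → A, μ.real (cyl A w) ^ s / wordSum μ s n = 1 := by
  rw [← Finset.sum_div]
  exact div_self (H.wordSum_pos s n).ne'

theorem isProbabilityMeasure_gibbsAverage (s : ℝ) (x : X A) (N : ℕ) :
    IsProbabilityMeasure (gibbsAverage μ s x N) := by
  have h0 : (0 : ℝ) < (N : ℝ) + 1 := by positivity
  have h1 := H.wordSum_pos s (2 * (N + 1))
  have hnn : ∀ w : Fin (2 * (N + 1)) → A,
      0 ≤ ((N : ℝ) + 1)⁻¹ * (μ.real (cyl A w) ^ s / wordSum μ s (2 * (N + 1))) := fun w => by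
    have h2 := Real.rpow_pos_of_pos (H.real_cyl_pos w) s
    positivity
  constructor
  simp only [gibbsAverage, Measure.coe_finsetSum, Finset.sum_apply, Measure.smul_apply,
    measure_univ, smul_eq_mul, mul_one]
  rw [Finset.sum_const, ← ENNReal.ofReal_sum_of_nonneg fun w _ => hnn w, ← Finset.mul_sum,
    H.sum_rpow_div_wordSum, mul_one, Finset.card_range, nsmul_eq_mul,
    ENNReal.ofReal_inv_of_pos h0]
  have h2 : ENNReal.ofReal ((N : ℝ) + 1) = ((N + 1 : ℕ) : ENNReal) := by
    rw [← ENNReal.ofReal_natCast]; push_cast; rfl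
  rw [h2, ENNReal.mul_inv_cancel (by simp) (by simp)]

theorem tendsto_integral_gibbsAverage (s : ℝ) (x : X A) {f : X A → ℝ} (hf : Continuous f) :
    Tendsto (fun N => ∫ y, f (shift A y) ∂(gibbsAverage μ s x N) -
      ∫ y, f y ∂(gibbsAverage μ s x N)) atTop (𝓝 0) := by
  obtain ⟨B, hB⟩ := (isCompact_univ (X := X A)).exists_bound_of_continuousOn hf.continuousOn
  have hlim : Tendsto (fun N : ℕ => 2 * B * (((N : ℝ) + 1)⁻¹)) atTop (𝓝 0) := by
    have := (tendsto_one_div_add_atTop_nhds_zero_nat (𝕜 := ℝ)).const_mul (2 * B)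
    simpa using this
  refine squeeze_zero_norm (fun N => ?_) hlim
  have h0 : (0 : ℝ) < (N : ℝ) + 1 := by positivity
  rw [H.integral_gibbsAverage, H.integral_gibbsAverage, ← Finset.sum_sub_distrib]
  have h1 : ∀ j, ((N : ℝ) + 1)⁻¹ * ∑ w : Fin (2 * (N + 1)) → A,
        μ.real (cyl A w) ^ s / wordSum μ s (2 * (N + 1)) * f (shift A ((shift A)^[j] (wcat w x))) =
      ((N : ℝ) + 1)⁻¹ * ∑ w : Fin (2 * (N + 1)) → A,
        μ.real (cyl A w) ^ s / wordSum μ s (2 * (N + 1)) * f ((shift A)^[j + 1] (wcat w x)) := by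
    intro j; simp only [Function.iterate_succ_apply']
  simp only [h1]
  rw [Finset.sum_range_sub (fun j => ((N : ℝ) + 1)⁻¹ * ∑ w : Fin (2 * (N + 1)) → A,
        μ.real (cyl A w) ^ s / wordSum μ s (2 * (N + 1)) * f ((shift A)^[j] (wcat w x))),
    ← mul_sub, ← Finset.sum_sub_distrib, norm_mul, norm_inv,
    Real.norm_of_nonneg h0.le, mul_comm]
  refine mul_le_mul_of_nonneg_right ?_ (by positivity)
  refine (norm_sum_le _ _).trans ?_
  have h2 : ∀ w ∈ (Finset.univ : Finset (Fin (2 * (N + 1)) → A)),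
      ‖μ.real (cyl A w) ^ s / wordSum μ s (2 * (N + 1)) * f ((shift A)^[N + 1] (wcat w x)) -
        μ.real (cyl A w) ^ s / wordSum μ s (2 * (N + 1)) * f ((shift A)^[0] (wcat w x))‖ ≤
      μ.real (cyl A w) ^ s / wordSum μ s (2 * (N + 1)) * (2 * B) := by
    intro w _
    have h3 := Real.rpow_pos_of_pos (H.real_cyl_pos w) s
    have h4 := H.wordSum_pos s (2 * (N + 1))
    rw [← mul_sub, norm_mul, Real.norm_of_nonneg (by positivity)]
    refine mul_le_mul_of_nonneg_left ?_ (by positivity)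
    refine (norm_sub_le _ _).trans ?_
    linarith [hB ((shift A)^[N + 1] (wcat w x)) (mem_univ _),
      hB ((shift A)^[0] (wcat w x)) (mem_univ _)]
  refine (Finset.sum_le_sum h2).trans ?_
  rw [← Finset.sum_mul, H.sum_rpow_div_wordSum, one_mul]

theorem sum_rpow_mul_indicator_le (s : ℝ) (x : X A) {j k l M : ℕ} (hM : M = j + (k + l))
    (v : Fin k → A) :
    ∑ w : Fin M → A, μ.real (cyl A w) ^ s / wordSum μ s M *
      (cyl A v).indicator (fun _ => (1 : ℝ)) ((shift A)^[j] (wcat w x)) ≤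
    Real.exp (4 * (|s| * tail φ 0)) * μ.real (cyl A v) ^ s / wordSum μ s k := by
  subst hM
  set c := |s| * tail φ 0 with hc
  have hj := H.wordSum_pos s j
  have hk := H.wordSum_pos s k
  have hl := H.wordSum_pos s l
  have hM := H.wordSum_pos s (j + (k + l))
  have hind : ∀ (u : Fin j → A) (v' : Fin k → A) (u' : Fin l → A),
      (cyl A v).indicator (fun _ => (1 : ℝ))
        ((shift A)^[j] (wcat (Fin.append u (Fin.append v' u')) x)) ≠ 0 → v' = v := by
    intro u v' u' h
    have h1 := mem_of_indicator_ne_zero h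
    have h2 := wcat_mem_cyl (Fin.append u (Fin.append v' u')) x
    rw [cyl_append, cyl_append] at h2
    exact ((mem_cyl_iff _ _).1 h2.2.1).symm.trans ((mem_cyl_iff _ _).1 h1)
  have hstep : ∑ w : Fin (j + (k + l)) → A, μ.real (cyl A w) ^ s *
      (cyl A v).indicator (fun _ => (1 : ℝ)) ((shift A)^[j] (wcat w x)) ≤
      Real.exp (2 * c) * (wordSum μ s j * (μ.real (cyl A v) ^ s * wordSum μ s l)) := by
    rw [sum_append]
    have h1 : ∀ u : Fin j → A, ∑ w' : Fin (k + l) → A, μ.real (cyl A (Fin.append u w')) ^ s *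
        (cyl A v).indicator (fun _ => (1 : ℝ)) ((shift A)^[j] (wcat (Fin.append u w') x)) ≤
        μ.real (cyl A u) ^ s * (Real.exp (2 * c) * (μ.real (cyl A v) ^ s * wordSum μ s l)) := by
      intro u
      rw [sum_append, Finset.sum_eq_single v]
      · rw [wordSum, Finset.mul_sum, Finset.mul_sum, Finset.mul_sum]
        refine Finset.sum_le_sum fun u' _ => ?_
        have h2 := (H.rpow_cyl_append s u (Fin.append v u')).2
        have h3 := (H.rpow_cyl_append s v u').2
        have hu := Real.rpow_pos_of_pos (H.real_cyl_pos u) s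
        have hv := Real.rpow_pos_of_pos (H.real_cyl_pos (Fin.append u (Fin.append v u'))) s
        calc _ ≤ μ.real (cyl A (Fin.append u (Fin.append v u'))) ^ s * 1 := by
              refine mul_le_mul_of_nonneg_left ?_ hv.le
              exact indicator_le_self' (fun _ _ => zero_le_one) _
          _ ≤ Real.exp c * (μ.real (cyl A u) ^ s *
              (Real.exp c * (μ.real (cyl A v) ^ s * μ.real (cyl A u') ^ s))) := by
            rw [mul_one]
            exact h2.trans (by gcongr)
          _ = _ := by rw [two_mul, Real.exp_add]; ring
      · intro v' _ hv'
        refine Finset.sum_eq_zero fun u' _ => ?_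
        rw [not_not.1 fun h => hv' (hind u v' u' h), mul_zero]
      · simp
    refine (Finset.sum_le_sum fun u _ => h1 u).trans (le_of_eq ?_)
    rw [← Finset.sum_mul]
    change wordSum μ s j * _ = _
    ring
  have hZ : Real.exp (-(2 * c)) * (wordSum μ s j * (wordSum μ s k * wordSum μ s l)) ≤
      wordSum μ s (j + (k + l)) := by
    refine le_trans ?_ (H.le_wordSum_add s j (k + l))
    rw [← hc]
    calc _ = Real.exp (-c) * (wordSum μ s j * (Real.exp (-c) *
          (wordSum μ s k * wordSum μ s l))) := by
          rw [two_mul, neg_add, Real.exp_add]; ring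
      _ ≤ _ := by
          have := H.le_wordSum_add s k l
          gcongr
  simp only [div_mul_eq_mul_div]
  rw [← Finset.sum_div, div_le_div_iff₀ hM hk]
  have hv := Real.rpow_pos_of_pos (H.real_cyl_pos v) s
  calc _ ≤ Real.exp (2 * c) * (wordSum μ s j * (μ.real (cyl A v) ^ s * wordSum μ s l)) *
        wordSum μ s k := by gcongr
    _ = Real.exp (4 * c) * μ.real (cyl A v) ^ s *
        (Real.exp (-(2 * c)) * (wordSum μ s j * (wordSum μ s k * wordSum μ s l))) := by
      rw [show 2 * c = 4 * c + -(2 * c) by ring, Real.exp_add,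
        show -(4 * c + -(2 * c)) = -(2 * c) by ring]
      ring
    _ ≤ _ := by gcongr

theorem real_gibbsAverage_le (s : ℝ) (x : X A) {N k : ℕ} (hk : k ≤ N) (v : Fin k → A) :
    (gibbsAverage μ s x N).real (cyl A v) ≤
      Real.exp (4 * (|s| * tail φ 0)) * μ.real (cyl A v) ^ s / wordSum μ s k := by
  have := H.nonempty
  have h0 : (0 : ℝ) < (N : ℝ) + 1 := by positivity
  rw [← integral_indicator_clopen (isClopen_cyl v), H.integral_gibbsAverage]
  have h1 : ∀ j ∈ Finset.range (N + 1), ((N : ℝ) + 1)⁻¹ * ∑ w : Fin (2 * (N + 1)) → A,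
      μ.real (cyl A w) ^ s / wordSum μ s (2 * (N + 1)) *
        (cyl A v).indicator (fun _ => (1 : ℝ)) ((shift A)^[j] (wcat w x)) ≤
      ((N : ℝ) + 1)⁻¹ *
        (Real.exp (4 * (|s| * tail φ 0)) * μ.real (cyl A v) ^ s / wordSum μ s k) := by
    intro j hj
    rw [Finset.mem_range] at hj
    refine mul_le_mul_of_nonneg_left ?_ (by positivity)
    exact H.sum_rpow_mul_indicator_le s x
      (show 2 * (N + 1) = j + (k + (2 * (N + 1) - j - k)) by omega) v
  refine (Finset.sum_le_sum h1).trans (le_of_eq ?_)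
  rw [Finset.sum_const, Finset.card_range, nsmul_eq_mul]
  push_cast
  rw [← mul_assoc, mul_inv_cancel₀ h0.ne', one_mul]

theorem exists_invProb_gibbs (s : ℝ) : ∃ η : Measure (X A), InvProb A η ∧
    ∀ (k : ℕ) (v : Fin k → A), η.real (cyl A v) ≤
      Real.exp (4 * (|s| * tail φ 0)) * μ.real (cyl A v) ^ s / wordSum μ s k := by
  have := H.nonempty
  let x : X A := fun _ => Classical.arbitrary A
  obtain ⟨η, hη, h⟩ := exists_invProb_limit (gibbsAverage μ s x)
    (H.isProbabilityMeasure_gibbsAverage s x) fun f hf => H.tendsto_integral_gibbsAverage s x hf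
  refine ⟨η, hη, fun k v => h _ (isClopen_cyl v) _ ?_⟩
  filter_upwards [eventually_ge_atTop k] with N hN
  exact H.real_gibbsAverage_le s x hN v

theorem entSeq_nonneg {η : Measure (X A)} (hη : InvProb A η) (n : ℕ) : 0 ≤ entSeq A η n := by
  have := hη.1
  rw [entSeq, neg_mul, ← mul_neg, ← Finset.sum_neg_distrib]
  refine mul_nonneg (by positivity) (Finset.sum_nonneg fun w _ => ?_)
  rw [neg_nonneg]
  exact mul_nonpos_of_nonneg_of_nonpos ENNReal.toReal_nonneg
    (Real.log_nonpos ENNReal.toReal_nonneg measureReal_le_one)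

theorem tendsto_log_wordSum_add {s L : ℝ}
    (hL : Tendsto (fun n : ℕ => Real.log (wordSum μ s n) / n) atTop (𝓝 L)) (c : ℝ) :
    Tendsto (fun n : ℕ => (Real.log (wordSum μ s n) + c) / n) atTop (𝓝 L) := by
  have := hL.add (tendsto_const_div_atTop_nhds_zero_nat c)
  rw [add_zero] at this
  exact this.congr fun n => (add_div _ _ _).symm

theorem entropy_add_le {η : Measure (X A)} (hη : InvProb A η) {s L : ℝ}
    (hL : Tendsto (fun n : ℕ => Real.log (wordSum μ s n) / n) atTop (𝓝 L)) :
    entropy A η + s * ∫ x, φ x ∂η ≤ L := by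
  have h1 := (H.tendsto_log_wordSum_add hL (|s| * tail φ 0)).sub_const (s * ∫ x, φ x ∂η)
  have h2 : entropy A η ≤ L - s * ∫ x, φ x ∂η := by
    rw [← h1.liminf_eq, entropy]
    refine liminf_le_liminf ?_ (isBoundedUnder_of ⟨0, H.entSeq_nonneg hη⟩)
      h1.isBoundedUnder_le.isCoboundedUnder_ge
    filter_upwards [eventually_gt_atTop 0] with n hn
    linarith [H.entSeq_add_le hη s hn]
  linarith

theorem exists_le_entropy_add {s L : ℝ}
    (hL : Tendsto (fun n : ℕ => Real.log (wordSum μ s n) / n) atTop (𝓝 L)) :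
    ∃ η, InvProb A η ∧ L ≤ entropy A η + s * ∫ x, φ x ∂η := by
  obtain ⟨η, hη, hb⟩ := H.exists_invProb_gibbs s
  refine ⟨η, hη, ?_⟩
  have h1 := (H.tendsto_log_wordSum_add hL
    (-(4 * (|s| * tail φ 0) + |s| * tail φ 0))).sub_const (s * ∫ x, φ x ∂η)
  have h3 := (H.tendsto_log_wordSum_add hL (|s| * tail φ 0)).sub_const (s * ∫ x, φ x ∂η)
  have hbd : IsBoundedUnder (· ≤ ·) atTop (entSeq A η) := by
    refine h3.isBoundedUnder_le.mono_le ?_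
    filter_upwards [eventually_gt_atTop 0] with n hn
    linarith [H.entSeq_add_le hη s hn]
  have h2 : L - s * ∫ x, φ x ∂η ≤ entropy A η := by
    rw [← h1.liminf_eq, entropy]
    refine liminf_le_liminf ?_ h1.isBoundedUnder_ge hbd.isCoboundedUnder_ge
    filter_upwards [eventually_gt_atTop 0] with n hn
    have := H.le_entSeq_add hη s hn (hb n)
    rw [sub_eq_add_neg] at this
    linarith
  linarith

/-- The variational principle for multiples of `φ`. -/
theorem tendsto_pressure (s : ℝ) : Tendsto (fun n : ℕ => Real.log (wordSum μ s n) / n) atTop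
    (𝓝 (pressure A fun x => s * φ x)) := by
  obtain ⟨L, hL, -⟩ := H.exists_tendsto_wordSum s
  have hle : ∀ r ∈ {r | ∃ η : Measure (X A), InvProb A η ∧
      r = entropy A η + ∫ x, s * φ x ∂η}, r ≤ L := by
    rintro r ⟨η, hη, rfl⟩
    rw [integral_const_mul]
    exact H.entropy_add_le hη hL
  obtain ⟨η, hη, h⟩ := H.exists_le_entropy_add hL
  have hLp : L = pressure A fun x => s * φ x := by
    refine le_antisymm (h.trans (le_csSup ⟨L, hle⟩ ⟨η, hη, ?_⟩)) (csSup_le ⟨_, η, hη, rfl⟩ hle)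
    rw [integral_const_mul]
  rwa [← hLp]

theorem exp_pressure_le (s : ℝ) (n : ℕ) : Real.exp (n * pressure A fun x => s * φ x) ≤
    Real.exp (|s| * tail φ 0) * wordSum μ s n := by
  obtain ⟨L, hL, h⟩ := H.exists_tendsto_wordSum s
  rw [← tendsto_nhds_unique hL (H.tendsto_pressure s)]
  rw [← Real.exp_log (H.wordSum_pos s n), ← Real.exp_add]
  exact Real.exp_le_exp.2 (by linarith [h n])

theorem pressure_one : (pressure A fun x => 1 * φ x) = 0 := by
  refine tendsto_nhds_unique (H.tendsto_pressure 1) ?_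
  simp [H.wordSum_one]

end Equilibrium
end Variational

section Gap
variable {A}

namespace Equilibrium

variable {φ : X A → ℝ} {μ : Measure (X A)} (H : Equilibrium φ μ)
include H

theorem pressure_le_sub {κ : ℝ} (hκ : ∀ x, φ x ≤ -κ) {s s' : ℝ} (h : s ≤ s') :
    (pressure A fun x => s' * φ x) ≤ (pressure A fun x => s * φ x) - κ * (s' - s) := by
  obtain ⟨η, hη, h1⟩ := H.exists_le_entropy_add (H.tendsto_pressure s')
  have h2 := H.entropy_add_le hη (H.tendsto_pressure s)
  have := hη.1
  have h3 := mul_le_mul_of_nonneg_left (H.integral_le_of_le H.cont hκ η) (sub_nonneg.2 h)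
  linarith

theorem sub_le_pressure {B : ℝ} (hB : ∀ x, |φ x| ≤ B) {s s' : ℝ} (h : s ≤ s') :
    (pressure A fun x => s * φ x) - B * (s' - s) ≤ pressure A fun x => s' * φ x := by
  obtain ⟨η, hη, h1⟩ := H.exists_le_entropy_add (H.tendsto_pressure s)
  have h2 := H.entropy_add_le hη (H.tendsto_pressure s')
  have := hη.1
  have h4 := H.integral_le_of_le (f := fun x => -φ x) H.cont.neg (c := B) (fun x => by
    linarith [(abs_le.1 (hB x)).1]) η
  rw [integral_neg] at h4
  have h3 := mul_le_mul_of_nonneg_left h4 (sub_nonneg.2 h)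
  linarith

theorem strictAnti_pressure : StrictAnti fun s : ℝ => pressure A fun x => s * φ x := by
  obtain ⟨κ, hκ0, hκ⟩ := H.exists_neg_bound
  intro s s' h
  have h1 := H.pressure_le_sub hκ h.le
  have h2 : 0 < κ * (s' - s) := mul_pos hκ0 (sub_pos.2 h)
  change (pressure A fun x => s' * φ x) < pressure A fun x => s * φ x
  linarith

theorem continuous_pressure : Continuous fun s : ℝ => pressure A fun x => s * φ x := by
  obtain ⟨B, hB0, hB⟩ := H.exists_bound
  refine (LipschitzWith.of_dist_le_mul (K := ⟨B, hB0.le⟩) fun s s' => ?_).continuous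
  rw [Real.dist_eq, Real.dist_eq]
  change _ ≤ B * _
  wlog h : s ≤ s' generalizing s s'
  · rw [abs_sub_comm, abs_sub_comm s]; exact this s' s (le_of_not_ge h)
  have h1 := H.sub_le_pressure hB h
  have h2 := H.strictAnti_pressure.antitone h
  rw [abs_of_nonneg (sub_nonneg.2 h2), abs_sub_comm, abs_of_nonneg (sub_nonneg.2 h)]
  linarith

theorem supInt_neg : supInt A φ < 0 := by
  obtain ⟨κ, hκ0, hκ⟩ := H.exists_neg_bound
  refine (H.supInt_le fun η hη => ?_).trans_lt (neg_neg_of_pos hκ0)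
  have := hη.1
  exact H.integral_le_of_le H.cont hκ η

theorem iterate_transfer_one_sub (c : ℝ) (f : X A → ℝ) (n : ℕ) (x : X A) :
    (transfer φ)^[n] (fun y => 1 - c * f y) x = 1 - c * (transfer φ)^[n] f x := by
  have h := congrFun (H.iterate_transfer_one n) x
  rw [iterate_transfer_apply] at h
  rw [iterate_transfer_apply, iterate_transfer_apply, Finset.mul_sum]
  nth_rw 2 [← h]
  rw [← Finset.sum_sub_distrib]
  exact Finset.sum_congr rfl fun w _ => by ring

theorem integral_exp_neg_birkhoffSum_box_le (m : ℕ) (z : X A) : ∃ δ : ℝ, 0 < δ ∧ ∀ N : ℕ,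
    ∫ x, Real.exp (-birkhoffSum ((shift A)^[m]) ((box m z).indicator fun _ => (1 : ℝ)) N x) ∂μ ≤
      Real.exp (-(N * δ)) := by
  have := H.isProb
  set b : X A → ℝ := (box m z).indicator fun _ => (1 : ℝ) with hb
  have hbc : Continuous b := continuous_indicator_one (isClopen_box m z)
  have h1e : (0 : ℝ) < 1 - Real.exp (-1) := by
    have := Real.exp_lt_one_iff.2 (show (-1 : ℝ) < 0 by norm_num)
    linarith
  have hg : ∀ x, Real.exp (-b x) = 1 - (1 - Real.exp (-1)) * b x := by
    intro x
    by_cases hx : x ∈ box m z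
    · simp [hb, indicator_of_mem hx]
    · simp [hb, indicator_of_notMem hx]
  set δ := (1 - Real.exp (-1)) * (Real.exp (-tail φ 0) * μ.real (box m z)) with hδ
  have hm := H.real_box_pos m z
  refine ⟨δ, by positivity, fun N => ?_⟩
  have hcont : ∀ N, Continuous (birkhoffSum ((shift A)^[m]) b N) := fun N => by
    unfold birkhoffSum
    exact continuous_finsetSum _ fun i _ =>
      hbc.comp ((continuous_iterate_shift m).iterate i)
  induction N with
  | zero => simp
  | succ N ih =>
    have h1 : ∀ x, Real.exp (-birkhoffSum ((shift A)^[m]) b (N + 1) x) =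
        Real.exp (-b x) * Real.exp (-birkhoffSum ((shift A)^[m]) b N ((shift A)^[m] x)) := by
      intro x
      rw [birkhoffSum_succ', neg_add, Real.exp_add]
    simp_rw [h1]
    have hc1 : Continuous fun x => Real.exp (-b x) := Real.continuous_exp.comp hbc.neg
    have hc2 : Continuous fun x => Real.exp (-birkhoffSum ((shift A)^[m]) b N x) :=
      Real.continuous_exp.comp (hcont N).neg
    rw [H.integral_mul_comp hc1 hc2 m]
    have h2 : ∀ x, (transfer φ)^[m] (fun x => Real.exp (-b x)) x ≤ Real.exp (-δ) := by
      intro x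
      simp_rw [hg]
      rw [H.iterate_transfer_one_sub]
      have h3 := mul_le_mul_of_nonneg_left (H.le_iterate_transfer_box m z x) h1e.le
      have h4 := Real.add_one_le_exp (-δ)
      linarith
    calc _ ≤ ∫ x, Real.exp (-δ) * Real.exp (-birkhoffSum ((shift A)^[m]) b N x) ∂μ := by
          refine integral_mono (H.integrable ((continuous_iterate_transfer H.cont hc1 m).mul hc2))
            (H.integrable (continuous_const.mul hc2)) fun x => ?_
          exact mul_le_mul_of_nonneg_right (h2 x) (Real.exp_pos _).le
      _ ≤ Real.exp (-δ) * Real.exp (-(N * δ)) := by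
          rw [integral_const_mul]
          exact mul_le_mul_of_nonneg_left ih (Real.exp_pos _).le
      _ = _ := by
          rw [← Real.exp_add]; congr 1; push_cast; ring

theorem birkhoffSum_add_card_le {m : ℕ} {z : X A}
    (hz : ∀ x ∈ box m z, birkhoffSum (shift A) φ m x - m * supInt A φ ≤ -tail φ 0 - 1)
    (N : ℕ) (x : X A) :
    birkhoffSum (shift A) φ (m * N) x - (m * N : ℕ) * supInt A φ +
      birkhoffSum ((shift A)^[m]) ((box m z).indicator fun _ => (1 : ℝ)) N x ≤ tail φ 0 := by
  set γ := supInt A φ with hγ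
  set v : X A → ℝ := fun x => ⨆ n : ℕ, (birkhoffSum (shift A) φ n x - n * γ) with hv
  have hbdd : ∀ x, BddAbove (range fun n : ℕ => birkhoffSum (shift A) φ n x - n * γ) := by
    rintro x
    refine ⟨tail φ 0, ?_⟩
    rintro _ ⟨n, rfl⟩
    have := H.birkhoffSum_le n x
    simp only; linarith
  have hv0 : ∀ x, 0 ≤ v x := fun x => by simpa using le_ciSup (hbdd x) 0
  have hv1 : ∀ x, v x ≤ tail φ 0 := fun x => ciSup_le fun n => by
    have := H.birkhoffSum_le n x
    linarith
  have hstep : ∀ x, birkhoffSum (shift A) φ m x - m * γ ≤ v x - v ((shift A)^[m] x) := by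
    intro x
    have : v ((shift A)^[m] x) ≤ v x - (birkhoffSum (shift A) φ m x - m * γ) := by
      refine ciSup_le fun n => ?_
      have h1 := le_ciSup (hbdd x) (m + n)
      simp only [birkhoffSum_add] at h1
      push_cast at h1
      change _ ≤ v x at h1
      linarith
    linarith
  have hstep' : ∀ x, birkhoffSum (shift A) φ m x - m * γ +
      (box m z).indicator (fun _ => (1 : ℝ)) x ≤ v x - v ((shift A)^[m] x) := by
    intro x
    by_cases hx : x ∈ box m z
    · rw [indicator_of_mem hx]
      linarith [hz x hx, hv0 x, hv1 ((shift A)^[m] x)]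
    · rw [indicator_of_notMem hx]
      linarith [hstep x]
  have hind : ∀ N x, birkhoffSum (shift A) φ (m * N) x - (m * N : ℕ) * γ +
      birkhoffSum ((shift A)^[m]) ((box m z).indicator fun _ => (1 : ℝ)) N x ≤
      v x - v ((shift A)^[m * N] x) := by
    intro N
    induction N with
    | zero => intro x; simp
    | succ N ih =>
      intro x
      have h1 := ih ((shift A)^[m] x)
      have h2 := hstep' x
      rw [birkhoffSum_succ', Nat.mul_succ, add_comm (m * N) m, birkhoffSum_add,
        add_comm m (m * N), Function.iterate_add_apply]
      push_cast at h1 ⊢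
      linarith
  linarith [hind N x, hv1 x, hv0 ((shift A)^[m * N] x)]

theorem wordSum_two_eq (n : ℕ) : wordSum μ 2 n = ∫ x, μ.real (box n x) ∂μ := by
  have := H.isProb
  have := H.nonempty
  have h := integral_word μ n fun w => μ.real (cyl A w)
  simp only [cyl_restrict] at h
  rw [h, wordSum]
  refine Finset.sum_congr rfl fun w _ => ?_
  rw [show (2 : ℝ) = ((2 : ℕ) : ℝ) by norm_num, Real.rpow_natCast, sq]

theorem integrable_real_box (n : ℕ) : Integrable (fun x => μ.real (box n x)) μ := by
  have := H.isProb
  have hm : Measurable fun x : X A => μ.real (cyl A fun i : Fin n => x i) :=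
    (Measurable.of_discrete (f := fun w : Fin n → A => μ.real (cyl A w))).comp
      (measurable_pi_lambda _ fun i => measurable_pi_apply (i : ℕ))
  simp only [cyl_restrict] at hm
  refine Integrable.of_bound hm.aestronglyMeasurable 1 (ae_of_all _ fun x => ?_)
  rw [Real.norm_of_nonneg measureReal_nonneg]
  exact measureReal_le_one

theorem pressure_two_lt_of_box {m : ℕ} (hm : 0 < m) {z : X A}
    (hz : ∀ x ∈ box m z, birkhoffSum (shift A) φ m x - m * supInt A φ ≤ -tail φ 0 - 1) :
    (pressure A fun x => 2 * φ x) < supInt A φ := by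
  have := H.isProb
  obtain ⟨δ, hδ, hN⟩ := H.integral_exp_neg_birkhoffSum_box_le m z
  set γ := supInt A φ with hγ
  have hm' : (0 : ℝ) < m := by exact_mod_cast hm
  have hbc : Continuous ((box m z).indicator fun _ => (1 : ℝ)) :=
    continuous_indicator_one (isClopen_box m z)
  have key : ∀ N : ℕ, wordSum μ 2 (m * N) ≤
      Real.exp (2 * tail φ 0 + (m * N : ℕ) * γ - N * δ) := by
    intro N
    have hcont : Continuous fun x => Real.exp
        (-birkhoffSum ((shift A)^[m]) ((box m z).indicator fun _ => (1 : ℝ)) N x) := by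
      refine Real.continuous_exp.comp (Continuous.neg ?_)
      unfold birkhoffSum
      exact continuous_finsetSum _ fun i _ => hbc.comp ((continuous_iterate_shift m).iterate i)
    rw [H.wordSum_two_eq]
    calc _ ≤ ∫ x, Real.exp (2 * tail φ 0 + (m * N : ℕ) * γ) * Real.exp
          (-birkhoffSum ((shift A)^[m]) ((box m z).indicator fun _ => (1 : ℝ)) N x) ∂μ := by
          refine integral_mono (H.integrable_real_box _)
            (H.integrable (continuous_const.mul hcont)) fun x => ?_
          refine (H.real_box_le _ x).trans ?_
          rw [← Real.exp_add, ← Real.exp_add]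
          refine Real.exp_le_exp.2 ?_
          linarith [H.birkhoffSum_add_card_le hz N x]
      _ ≤ Real.exp (2 * tail φ 0 + (m * N : ℕ) * γ) * Real.exp (-(N * δ)) := by
          rw [integral_const_mul]
          exact mul_le_mul_of_nonneg_left (hN N) (Real.exp_pos _).le
      _ = _ := by rw [← Real.exp_add]; congr 1
  have hle : (pressure A fun x => 2 * φ x) ≤ γ - δ / m := by
    have h1 : Tendsto (fun N : ℕ => m * N) atTop atTop :=
      tendsto_id.const_mul_atTop' hm
    have h2 := (H.tendsto_pressure 2).comp h1
    have h3 : Tendsto (fun N : ℕ => (2 * tail φ 0 / m) / N + (γ - δ / m)) atTop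
        (𝓝 (0 + (γ - δ / m))) :=
      (tendsto_const_div_atTop_nhds_zero_nat _).add_const _
    rw [zero_add] at h3
    refine le_of_tendsto_of_tendsto h2 h3 ?_
    filter_upwards [eventually_gt_atTop 0] with N hN0
    have hN' : (0 : ℝ) < N := by exact_mod_cast hN0
    have h4 := Real.log_le_log (H.wordSum_pos 2 _) (key N)
    rw [Real.log_exp] at h4
    simp only [Function.comp]
    push_cast at h4 ⊢
    rw [div_le_iff₀ (by positivity)]
    refine h4.trans (le_of_eq ?_)
    field_simp
    ring
  have : 0 < δ / m := by positivity
  linarith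

theorem pressure_two_lt_or : (pressure A fun x => 2 * φ x) < supInt A φ ∨
    ∃ K : ℝ, ∀ n x, |birkhoffSum (shift A) φ n x - n * supInt A φ| ≤ K := by
  by_cases h : ∀ n x, -(2 * tail φ 0 + 1) ≤ birkhoffSum (shift A) φ n x - n * supInt A φ
  · refine Or.inr ⟨2 * tail φ 0 + 1, fun n x => abs_le.2 ⟨h n x, ?_⟩⟩
    linarith [H.birkhoffSum_le n x, H.tail_nonneg 0]
  · push Not at h
    obtain ⟨m, z, hz⟩ := h
    have h0 := H.tail_nonneg 0
    refine Or.inl (H.pressure_two_lt_of_box (m := m) (z := z) ?_ fun x hx => ?_)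
    · rcases Nat.eq_zero_or_pos m with rfl | hm
      · simp at hz; linarith
      · exact hm
    · linarith [H.birkhoffSum_le_add hx]

end Equilibrium
end Gap

section Livsic
variable {A}

/-- The sequence `a ⋯ a x` with `n` copies of the symbol `a`. -/
def prefixed (a : A) (n : ℕ) (x : X A) : X A := wcat (fun _ : Fin n => a) x

theorem prefixed_of_lt (a : A) {n i : ℕ} (x : X A) (h : i < n) : prefixed a n x i = a :=
  wcat_of_lt _ _ h

theorem prefixed_add (a : A) (n : ℕ) (x : X A) (i : ℕ) : prefixed a n x (i + n) = x i :=
  wcat_add _ _ _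

theorem iterate_shift_prefixed (a : A) (n : ℕ) (x : X A) :
    (shift A)^[n] (prefixed a n x) = x := iterate_shift_wcat _ _

theorem shift_prefixed_succ (a : A) (n : ℕ) (x : X A) :
    shift A (prefixed a (n + 1) x) = prefixed a n x := by
  ext i
  change prefixed a (n + 1) x (i + 1) = _
  by_cases h : i < n
  · rw [prefixed_of_lt a x h, prefixed_of_lt a x (by omega)]
  · obtain ⟨k, rfl⟩ := Nat.exists_eq_add_of_le' (not_lt.1 h)
    rw [prefixed_add, add_assoc, prefixed_add]

theorem continuous_prefixed (a : A) (n : ℕ) : Continuous (prefixed a n : X A → X A) :=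
  continuous_wcat fun _ => a

theorem birkhoffSum_prefixed (f : X A → ℝ) (a : A) (n : ℕ) (x : X A) :
    birkhoffSum (shift A) f n (prefixed a n x) =
      ∑ k ∈ Finset.range n, f (prefixed a (k + 1) x) := by
  induction n with
  | zero => simp
  | succ n ih =>
    rw [birkhoffSum_succ', shift_prefixed_succ, ih, Finset.sum_range_succ, add_comm]

namespace Equilibrium

variable {φ : X A → ℝ} {μ : Measure (X A)} (H : Equilibrium φ μ)
include H

section Bounded

variable {K : ℝ} (hK : ∀ n x, |birkhoffSum (shift A) φ n x - n * supInt A φ| ≤ K)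
include hK

theorem birkhoffSum_periodic_eq {p : ℕ} {x : X A} (hx : (shift A)^[p] x = x) :
    birkhoffSum (shift A) φ p x = p * supInt A φ := by
  have h1 : ∀ j : ℕ, birkhoffSum (shift A) φ (p * j) x = j * birkhoffSum (shift A) φ p x := by
    intro j
    induction j with
    | zero => simp
    | succ j ih =>
      rw [Nat.mul_succ, add_comm, birkhoffSum_add, hx, ih]; push_cast; ring
  by_contra hne
  have hpos : 0 < |birkhoffSum (shift A) φ p x - p * supInt A φ| := abs_pos.2 (sub_ne_zero.2 hne)
  obtain ⟨j, hj⟩ := exists_nat_gt (K / |birkhoffSum (shift A) φ p x - p * supInt A φ|)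
  rw [div_lt_iff₀ hpos] at hj
  have h2 := hK (p * j) x
  rw [h1, show (j : ℝ) * birkhoffSum (shift A) φ p x - (p * j : ℕ) * supInt A φ =
    j * (birkhoffSum (shift A) φ p x - p * supInt A φ) by push_cast; ring, abs_mul,
    Nat.abs_cast] at h2
  linarith

theorem abs_birkhoffSum_prefixed_sub_le (a : A) (x : X A) (n l : ℕ) :
    |birkhoffSum (shift A) φ (n + 1) (prefixed a n x) -
      birkhoffSum (shift A) φ n (prefixed a n (shift A x)) - supInt A φ| ≤
      2 * tail φ l + tail φ n := by
  set y := shift A x with hy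
  set p := periodize (n + 1 + l) (prefixed a n x) with hp
  set r := periodize (n + l) (prefixed a n y) with hr
  have hpS := H.birkhoffSum_periodic_eq hK (iterate_shift_periodize (n + 1 + l) (prefixed a n x))
  have hrS := H.birkhoffSum_periodic_eq hK (iterate_shift_periodize (n + l) (prefixed a n y))
  rw [← hp, birkhoffSum_add] at hpS
  rw [← hr, birkhoffSum_add] at hrS
  have h1 := H.abs_birkhoffSum_sub_le (n := n + 1) (k := l) (x := p) (y := prefixed a n x)
    fun i hi => periodize_of_lt _ hi
  have h2 := H.abs_birkhoffSum_sub_le (n := n) (k := l) (x := r) (y := prefixed a n y)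
    fun i hi => periodize_of_lt _ hi
  have h3 := H.abs_birkhoffSum_sub_le (n := l) (k := n) (x := (shift A)^[n + 1] p)
    (y := (shift A)^[n] r) fun i hi => by
      rw [iterate_shift_apply, iterate_shift_apply]
      by_cases hil : i < l
      · rw [hp, hr, periodize_of_lt _ (by omega), periodize_of_lt _ (by omega), prefixed_add,
          show i + (n + 1) = i + 1 + n by ring, prefixed_add]
        rfl
      · obtain ⟨j, rfl⟩ := Nat.exists_eq_add_of_le' (not_lt.1 hil)
        rw [hp, hr, periodize, periodize, show j + l + (n + 1) = j + (n + 1 + l) by ring,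
          show j + l + n = j + (n + l) by ring, Nat.add_mod_right, Nat.add_mod_right,
          Nat.mod_eq_of_lt (by omega), Nat.mod_eq_of_lt (by omega),
          prefixed_of_lt _ _ (by omega), prefixed_of_lt _ _ (by omega)]
  push_cast at hpS hrS
  rw [abs_le] at h1 h2 h3 ⊢
  constructor <;> linarith [h1.1, h1.2, h2.1, h2.2, h3.1, h3.2]

/-- A Livšic-type theorem. -/
theorem exists_coboundary : ∃ u : X A → ℝ, Continuous u ∧
    ∀ x, φ x = u x - u (shift A x) + supInt A φ := by
  obtain ⟨a⟩ := H.nonempty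
  set γ := supInt A φ with hγ
  have hfix : φ (fun _ => a) = γ := by
    have := H.birkhoffSum_periodic_eq hK (p := 1) (x := fun _ => a) rfl
    simpa using this
  have hbd : ∀ k x, ‖φ (prefixed a (k + 1) x) - γ‖ ≤ Var A φ (k + 1) := fun k x => by
    rw [← hfix]
    exact H.abs_sub_le_Var fun i hi => prefixed_of_lt a x hi
  set U : X A → ℝ := fun x => ∑' k : ℕ, (φ (prefixed a (k + 1) x) - γ) with hU
  have hUc : Continuous U :=
    continuous_tsum (fun k => (H.cont.comp (continuous_prefixed a (k + 1))).sub continuous_const)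
      H.summable hbd
  have hlim : ∀ x, Tendsto (fun n : ℕ => birkhoffSum (shift A) φ n (prefixed a n x) - n * γ)
      atTop (𝓝 (U x)) := by
    intro x
    have hs : Summable fun k : ℕ => φ (prefixed a (k + 1) x) - γ :=
      Summable.of_norm_bounded H.summable fun k => hbd k x
    refine hs.hasSum.tendsto_sum_nat.congr fun n => ?_
    rw [birkhoffSum_prefixed, Finset.sum_sub_distrib]
    simp
  refine ⟨fun x => -U x, hUc.neg, fun x => ?_⟩
  have hle : ∀ n : ℕ, |birkhoffSum (shift A) φ (n + 1) (prefixed a n x) -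
      birkhoffSum (shift A) φ n (prefixed a n (shift A x)) - γ| ≤ tail φ n := by
    intro n
    have h1 : Tendsto (fun l => 2 * tail φ l + tail φ n) atTop (𝓝 (2 * 0 + tail φ n)) :=
      (H.tendsto_tail.const_mul 2).add_const _
    rw [mul_zero, zero_add] at h1
    exact ge_of_tendsto' h1 fun l => H.abs_birkhoffSum_prefixed_sub_le hK a x n l
  have h0 := squeeze_zero_norm (fun n => (Real.norm_eq_abs _).trans_le (hle n)) H.tendsto_tail
  have h1 : Tendsto (fun n : ℕ => birkhoffSum (shift A) φ (n + 1) (prefixed a n x) -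
      birkhoffSum (shift A) φ n (prefixed a n (shift A x)) - γ) atTop
      (𝓝 (U x + φ x - U (shift A x) - γ)) := by
    refine ((((hlim x).add_const (φ x)).sub (hlim (shift A x))).sub_const γ).congr fun n => ?_
    rw [birkhoffSum_succ, iterate_shift_prefixed]
    ring
  have := tendsto_nhds_unique h0 h1
  linarith

end Bounded

theorem supInt_eq_of_coboundary {u : X A → ℝ} (hu : Continuous u) {c : ℝ}
    (h : ∀ x, φ x = u x - u (shift A x) + c) : c = -Real.log (Fintype.card A) := by
  have := H.nonempty
  have hc0 : (0 : ℝ) < Fintype.card A := by exact_mod_cast Fintype.card_pos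
  have hsum : ∀ x, ∑ a : A, Real.exp (u (prepend A a x)) = Real.exp (u x - c) := by
    intro x
    have h1 := H.norm x
    have h2 : ∀ a : A, Real.exp (φ (prepend A a x)) =
        Real.exp (-(u x - c)) * Real.exp (u (prepend A a x)) := by
      intro a
      rw [h, shift_prepend, ← Real.exp_add]; congr 1; ring
    simp_rw [h2] at h1
    rw [← Finset.mul_sum, Real.exp_neg, inv_mul_eq_one₀ (Real.exp_pos _).ne'] at h1
    exact h1.symm
  obtain ⟨x, -, hx⟩ := (isCompact_univ (X := X A)).exists_isMaxOn univ_nonempty hu.continuousOn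
  obtain ⟨y, -, hy⟩ := (isCompact_univ (X := X A)).exists_isMinOn univ_nonempty hu.continuousOn
  have h1 : Real.exp (u x - c) ≤ Fintype.card A * Real.exp (u x) := by
    rw [← hsum]
    refine (Finset.sum_le_card_nsmul _ _ (Real.exp (u x)) fun a _ =>
      Real.exp_le_exp.2 (hx (mem_univ _))).trans ?_
    simp
  have h2 : Fintype.card A * Real.exp (u y) ≤ Real.exp (u y - c) := by
    rw [← hsum]
    refine le_trans ?_ (Finset.card_nsmul_le_sum _ _ (Real.exp (u y)) fun a _ =>
      Real.exp_le_exp.2 (hy (mem_univ _)))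
    simp
  have h3 := Real.log_le_log (Real.exp_pos _) h1
  have h4 := Real.log_le_log (by positivity) h2
  rw [Real.log_exp, Real.log_mul hc0.ne' (Real.exp_pos _).ne', Real.log_exp] at h3 h4
  linarith

theorem pressure_two_lt (hnot : ¬ ∃ u : X A → ℝ, Continuous u ∧
    ∀ x, φ x = u x - u (shift A x) - Real.log (Fintype.card A)) :
    (pressure A fun x => 2 * φ x) < supInt A φ := by
  refine H.pressure_two_lt_or.resolve_right ?_
  rintro ⟨K, hK⟩
  obtain ⟨u, hu, h⟩ := H.exists_coboundary hK
  refine hnot ⟨u, hu, fun x => ?_⟩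
  rw [sub_eq_add_neg, ← H.supInt_eq_of_coboundary hu h]
  exact h x

theorem existsUnique_pressure_eq (hnot : ¬ ∃ u : X A → ℝ, Continuous u ∧
    ∀ x, φ x = u x - u (shift A x) - Real.log (Fintype.card A)) :
    ∃ qs : ℝ, qs ∈ Ioo (-1 : ℝ) 0 ∧ (pressure A fun x => (1 - qs) * φ x) = supInt A φ ∧
      ∀ q : ℝ, (pressure A fun x => (1 - q) * φ x) = supInt A φ → q = qs := by
  have h1 : supInt A φ ∈ Ioo (pressure A fun x => 2 * φ x) (pressure A fun x => 1 * φ x) :=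
    ⟨H.pressure_two_lt hnot, by rw [H.pressure_one]; exact H.supInt_neg⟩
  obtain ⟨s, hs, hse⟩ := intermediate_value_Ioo' (show (1 : ℝ) ≤ 2 by norm_num)
    H.continuous_pressure.continuousOn h1
  refine ⟨1 - s, ⟨by linarith [hs.2], by linarith [hs.1]⟩, ?_, fun q hq => ?_⟩
  · rw [sub_sub_cancel]; exact hse
  · have := H.strictAnti_pressure.injective (a₁ := 1 - q) (a₂ := s) (hq.trans hse.symm)
    linarith

end Equilibrium
end Livsic

section Returns
variable {A}

/-- The points whose `k`-fold shift returns to their own cylinder of length `n`. -/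
def ret (n k : ℕ) : Set (X A) := {x | ∀ i < n, x (k + i) = x i}

theorem isClopen_ret (n k : ℕ) : IsClopen (ret n k : Set (X A)) := by
  have h : (ret n k : Set (X A)) = ⋂ i ∈ Finset.range n, {x | x (k + i) = x i} := by
    ext x; simp [ret]
  rw [h]
  refine isClopen_biInter_finset fun i _ => ?_
  have hc : Continuous fun x : X A => (x (k + i), x i) :=
    (continuous_apply _).prodMk (continuous_apply _)
  exact (isClopen_discrete {p : A × A | p.1 = p.2}).preimage hc

theorem box_inter_ret (n k : ℕ) (z : X A) :
    box n z ∩ ret n k = box n z ∩ (shift A)^[k] ⁻¹' box n z := by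
  ext x
  refine and_congr_right fun hx => ?_
  simp only [ret, box, mem_ofPred_eq, mem_preimage, iterate_shift_apply]
  refine forall₂_congr fun i hi => ?_
  rw [hx i hi, add_comm]

theorem box_inter_ret_subset {n k : ℕ} (hk : k ≤ n) (z : X A) :
    box n z ∩ ret n k ⊆ box n z ∩ (shift A)^[n] ⁻¹' box k ((shift A)^[n - k] z) := by
  rintro x ⟨hx, hr⟩
  refine ⟨hx, fun i hi => ?_⟩
  rw [iterate_shift_apply, iterate_shift_apply, ← hx _ (by omega),
    ← hr (i + (n - k)) (by omega)]
  congr 1; omega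

theorem box_inter_ret_subset_periodize {n k : ℕ} (hk : 0 < k) (z : X A) :
    box k z ∩ ret n k ⊆ box k z ∩ (shift A)^[k] ⁻¹' box n (periodize k z) := by
  rintro x ⟨hx, hr⟩
  refine ⟨hx, fun i => ?_⟩
  rw [iterate_shift_apply]
  induction i using Nat.strong_induction_on with
  | _ i ih =>
    intro hi
    rw [add_comm, hr i hi]
    by_cases hik : i < k
    · rw [periodize_of_lt _ hik, hx i hik]
    · obtain ⟨j, rfl⟩ := Nat.exists_eq_add_of_le' (not_lt.1 hik)
      rw [ih j (by omega) (by omega), periodize, periodize, Nat.add_mod_right]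

/-- The points avoiding `box n z` at the first `N` multiples of `n`. -/
def avoid (n : ℕ) (z : X A) (N : ℕ) : Set (X A) := {x | ∀ j < N, (shift A)^[j * n] x ∉ box n z}

theorem isClopen_avoid (n : ℕ) (z : X A) (N : ℕ) : IsClopen (avoid n z N) := by
  have h : avoid n z N = ⋂ j ∈ Finset.range N, ((shift A)^[j * n] ⁻¹' box n z)ᶜ := by
    ext x; simp [avoid]
  rw [h]
  exact isClopen_biInter_finset fun j _ =>
    ((isClopen_box n z).preimage (continuous_iterate_shift _)).compl

theorem avoid_succ (n : ℕ) (z : X A) (N : ℕ) :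
    avoid n z (N + 1) = (box n z)ᶜ ∩ (shift A)^[n] ⁻¹' avoid n z N := by
  ext x
  constructor
  · intro h
    refine ⟨by simpa using h 0 (by omega), fun j hj => ?_⟩
    have := h (j + 1) (by omega)
    rwa [Nat.succ_mul, Function.iterate_add_apply] at this
  · rintro ⟨h0, h1⟩ j hj
    cases j with
    | zero => simpa using h0
    | succ j =>
      rw [Nat.succ_mul, Function.iterate_add_apply]
      exact h1 j (by omega)

theorem exists_ret_of_notMem_avoid {n : ℕ} {z x : X A} (hx : x ∈ box n z) {N : ℕ}
    (h : (shift A)^[n] x ∉ avoid n z N) : ∃ j, 1 ≤ j ∧ j ≤ N ∧ x ∈ ret n (j * n) := by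
  simp only [avoid, mem_ofPred_eq, not_forall, not_not] at h
  obtain ⟨j, hj, h⟩ := h
  rw [← Function.iterate_add_apply, ← Nat.succ_mul] at h
  have h2 : x ∈ box n z ∩ ret n (j.succ * n) := by rw [box_inter_ret]; exact ⟨hx, h⟩
  exact ⟨j + 1, by omega, by omega, h2.2⟩

theorem retTime_le {n k : ℕ} {x : X A} (hk : 1 ≤ k) (h : x ∈ ret n k) : retTime A n x ≤ k + 1 :=
  Nat.sInf_le ⟨by omega, fun i hi => by simpa using h i hi⟩

/-- If `x` returns at all, then its return time is one more than its first return. -/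
theorem exists_retTime_eq {n k : ℕ} {x : X A} (hk : 1 ≤ k) (h : x ∈ ret n k) :
    ∃ j, 1 ≤ j ∧ retTime A n x = j + 1 ∧ x ∈ ret n j := by
  have hne : {k | 2 ≤ k ∧ ∀ i < n, x (k - 1 + i) = x i}.Nonempty :=
    ⟨k + 1, by omega, fun i hi => by simpa using h i hi⟩
  have h2 := Nat.sInf_mem hne
  change 2 ≤ retTime A n x ∧ ∀ i < n, x (retTime A n x - 1 + i) = x i at h2
  exact ⟨retTime A n x - 1, by omega, by omega, h2.2⟩

theorem retTime_eq_zero {n : ℕ} {x : X A} (h : ∀ k, 1 ≤ k → x ∉ ret n k) : retTime A n x = 0 := by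
  refine Nat.sInf_eq_zero.2 (Or.inr (eq_empty_of_forall_notMem fun k hk => ?_))
  exact h (k - 1) (by have := hk.1; omega) hk.2

namespace Equilibrium

variable {φ : X A → ℝ} {μ : Measure (X A)} (H : Equilibrium φ μ)
include H

theorem real_avoid_le (n : ℕ) (z : X A) (N : ℕ) :
    μ.real (avoid n z N) ≤ Real.exp (-(N * (Real.exp (-tail φ 0) * μ.real (box n z)))) := by
  have := H.isProb
  set δ := Real.exp (-tail φ 0) * μ.real (box n z) with hδ
  induction N with
  | zero => simp [measureReal_le_one]
  | succ N ih =>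
    set b : X A → ℝ := (box n z).indicator fun _ => (1 : ℝ) with hb
    have hbc : Continuous b := continuous_indicator_one (isClopen_box n z)
    have hac := continuous_indicator_one (isClopen_avoid n z N)
    have h1 : ∀ x, (avoid n z (N + 1)).indicator (fun _ => (1 : ℝ)) x =
        (1 - 1 * b x) * (avoid n z N).indicator (fun _ => (1 : ℝ)) ((shift A)^[n] x) := by
      intro x
      rw [avoid_succ]
      by_cases hx : x ∈ box n z
      · rw [indicator_of_notMem fun h => h.1 hx, hb, indicator_of_mem hx]; simp
      · rw [hb, indicator_of_notMem hx, mul_zero, sub_zero, one_mul]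
        by_cases hx' : (shift A)^[n] x ∈ avoid n z N
        · rw [indicator_of_mem hx', indicator_of_mem (show x ∈ (box n z)ᶜ ∩ _ from ⟨hx, hx'⟩)]
        · rw [indicator_of_notMem hx', indicator_of_notMem fun h => hx' h.2]
    have hgc : Continuous fun x => 1 - 1 * b x := by fun_prop
    rw [← integral_indicator_clopen (isClopen_avoid n z (N + 1))]
    simp_rw [h1]
    rw [H.integral_mul_comp hgc hac n]
    calc _ ≤ ∫ x, Real.exp (-δ) * (avoid n z N).indicator (fun _ => (1 : ℝ)) x ∂μ := by
          refine integral_mono (H.integrable ((continuous_iterate_transfer H.cont hgc n).mul hac))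
            (H.integrable (continuous_const.mul hac)) fun x => ?_
          refine mul_le_mul_of_nonneg_right ?_ (indicator_nonneg (fun _ _ => zero_le_one) x)
          rw [H.iterate_transfer_one_sub]
          have h3 := H.le_iterate_transfer_box n z x
          have h4 := Real.add_one_le_exp (-δ)
          linarith
      _ ≤ Real.exp (-δ) * Real.exp (-(N * δ)) := by
          rw [integral_const_mul, integral_indicator_clopen (isClopen_avoid n z N)]
          exact mul_le_mul_of_nonneg_left ih (Real.exp_pos _).le
      _ = _ := by
          rw [← Real.exp_add]; congr 1; push_cast; ring

/-- The number of blocks after which a point of `box n z` has a definite chance to have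
returned. -/
theorem real_box_inter_avoid_le (n : ℕ) (z : X A) (i : ℕ) {L : ℕ}
    (hL : Real.exp (tail φ 0) / μ.real (box n z) ≤ L) :
    μ.real (box n z ∩ (shift A)^[n] ⁻¹' avoid n z (i * L)) ≤
      Real.exp (tail φ 0) * μ.real (box n z) * Real.exp (-i) := by
  have hm := H.real_box_pos n z
  refine (H.real_box_inter_le n z (isClopen_avoid n z _)).trans ?_
  refine mul_le_mul_of_nonneg_left ((H.real_avoid_le n z _).trans ?_) (by positivity)
  refine Real.exp_le_exp.2 (neg_le_neg ?_)
  rw [div_le_iff₀ hm] at hL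
  have h1 : 1 ≤ (L : ℝ) * (Real.exp (-tail φ 0) * μ.real (box n z)) := by
    have := mul_le_mul_of_nonneg_left hL (Real.exp_pos (-tail φ 0)).le
    rw [← Real.exp_add, neg_add_cancel, Real.exp_zero] at this
    linarith
  push_cast
  rw [mul_assoc]
  exact le_mul_of_one_le_right (by positivity) h1

theorem real_box_inter_ret_le {n k : ℕ} (hk : n ≤ k) (z : X A) :
    μ.real (box n z ∩ ret n k) ≤ Real.exp (tail φ 0) * μ.real (box n z) * μ.real (box n z) := by
  have := H.isProb
  rw [box_inter_ret]
  obtain ⟨j, rfl⟩ := Nat.exists_eq_add_of_le' hk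
  rw [Function.iterate_add, preimage_comp]
  refine (H.real_box_inter_le n z
    ((isClopen_box n z).preimage (continuous_iterate_shift j))).trans_eq ?_
  rw [H.real_preimage (isClopen_box n z)]

theorem real_box_inter_ret_le_exp {κ : ℝ} (hκ : ∀ x, φ x ≤ -κ) {n k : ℕ} (hk : k ≤ n) (z : X A) :
    μ.real (box n z ∩ ret n k) ≤
      Real.exp (tail φ 0) * μ.real (box n z) * (Real.exp (tail φ 0) * Real.exp (-κ) ^ k) := by
  have := H.isProb
  have hm := H.real_box_pos n z
  refine (measureReal_mono (box_inter_ret_subset hk z)).trans ?_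
  refine (H.real_box_inter_le n z (isClopen_box k _)).trans ?_
  refine mul_le_mul_of_nonneg_left ((H.real_box_le k _).trans ?_) (by positivity)
  refine mul_le_mul_of_nonneg_left ?_ (Real.exp_pos _).le
  rw [← Real.exp_nat_mul]
  refine Real.exp_le_exp.2 ?_
  rw [birkhoffSum]
  refine (Finset.sum_le_card_nsmul _ _ (-κ) fun i _ => hκ _).trans ?_
  simp

theorem real_ret_le {n k : ℕ} (hk : 0 < k) :
    μ.real (ret n k) ≤ Real.exp (3 * tail φ 0 + n * supInt A φ) := by
  have := H.isProb
  have := H.nonempty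
  let x : X A := fun _ => Classical.arbitrary A
  rw [← sum_real_cyl_inter μ k (isClopen_ret n k).isOpen.measurableSet]
  have h1 : ∀ v ∈ (Finset.univ : Finset (Fin k → A)), μ.real (cyl A v ∩ ret n k) ≤
      μ.real (cyl A v) * Real.exp (3 * tail φ 0 + n * supInt A φ) := by
    intro v _
    rw [cyl_eq_box v x]
    have hm := H.real_box_pos k (wcat v x)
    refine (measureReal_mono (box_inter_ret_subset_periodize hk (wcat v x))).trans ?_
    refine (H.real_box_inter_le k _ (isClopen_box n _)).trans ?_
    rw [mul_comm (Real.exp _), mul_assoc]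
    refine mul_le_mul_of_nonneg_left ?_ hm.le
    calc _ ≤ Real.exp (tail φ 0) * Real.exp (2 * tail φ 0 + n * supInt A φ) :=
          mul_le_mul_of_nonneg_left (H.real_box_le_exp n _) (Real.exp_pos _).le
      _ = _ := by rw [← Real.exp_add]; congr 1; ring
  refine (Finset.sum_le_sum h1).trans_eq ?_
  rw [← Finset.sum_mul, sum_real_cyl, one_mul]

end Equilibrium
end Returns

section Growth
variable {A}

theorem tendsto_log_const_mul_rpow_mul {u : ℕ → ℝ} (hu : ∀ n, 0 < u n) {L : ℝ}
    (h : Tendsto (fun n : ℕ => Real.log (u n) / n) atTop (𝓝 L)) {C : ℝ} (hC : 0 < C) (p : ℝ) :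
    Tendsto (fun n : ℕ => Real.log (C * (n : ℝ) ^ p * u n) / n) atTop (𝓝 L) := by
  have h1 : Tendsto (fun n : ℕ => Real.log n / n) atTop (𝓝 0) :=
    (Real.isLittleO_log_id_atTop.tendsto_div_nhds_zero).comp tendsto_natCast_atTop_atTop
  have h2 := ((tendsto_const_div_atTop_nhds_zero_nat (Real.log C)).add (h1.const_mul p)).add h
  rw [mul_zero, zero_add, zero_add] at h2
  refine h2.congr' ?_
  filter_upwards [eventually_ge_atTop 1] with n hn
  have hn' : (0 : ℝ) < n := by exact_mod_cast hn
  rw [Real.log_mul (mul_pos hC (Real.rpow_pos_of_pos hn' p)).ne' (hu n).ne',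
    Real.log_mul hC.ne' (Real.rpow_pos_of_pos hn' p).ne', Real.log_rpow hn']
  ring

theorem eventually_exp_le {u : ℕ → ℝ} (hu : ∀ᶠ n in atTop, 0 < u n) {L L' : ℝ}
    (h : Tendsto (fun n : ℕ => Real.log (u n) / n) atTop (𝓝 L)) (hL : L' < L) :
    ∀ᶠ n : ℕ in atTop, Real.exp (n * L') ≤ u n := by
  filter_upwards [eventually_ge_atTop 1, hu, h.eventually_const_lt hL] with n hn hun h1
  have hn' : (0 : ℝ) < n := by exact_mod_cast hn
  rw [lt_div_iff₀' hn'] at h1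
  rw [← Real.le_log_iff_exp_le hun]
  exact h1.le

theorem eventually_le_exp {u : ℕ → ℝ} (hu : ∀ᶠ n in atTop, 0 < u n) {L L' : ℝ}
    (h : Tendsto (fun n : ℕ => Real.log (u n) / n) atTop (𝓝 L)) (hL : L < L') :
    ∀ᶠ n : ℕ in atTop, u n ≤ Real.exp (n * L') := by
  filter_upwards [eventually_ge_atTop 1, hu, h.eventually_lt_const hL] with n hn hun h1
  have hn' : (0 : ℝ) < n := by exact_mod_cast hn
  rw [div_lt_iff₀' hn'] at h1
  rw [← Real.log_le_iff_le_exp hun]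
  exact h1.le

/-- The `q`-th moment of the `n`-th return time. -/
noncomputable def moment (μ : Measure (X A)) (q : ℝ) (n : ℕ) : ENNReal :=
  ∫⁻ x, ENNReal.ofReal ((retTime A n x : ℝ) ^ q) ∂μ

theorem inv_mul_log_ofReal_exp {n : ℕ} (hn : 1 ≤ n) (L : ℝ) :
    (((n : ℝ)⁻¹ : ℝ) : EReal) * ENNReal.log (ENNReal.ofReal (Real.exp (n * L))) = (L : ℝ) := by
  have hn' : (n : ℝ) ≠ 0 := by positivity
  rw [ENNReal.log_ofReal_of_pos (Real.exp_pos _), Real.log_exp, ← EReal.coe_mul,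
    inv_mul_cancel_left₀ hn']

theorem tendsto_RSeq {μ : Measure (X A)} {q L : ℝ}
    (h1 : ∀ L' < L, ∀ᶠ n : ℕ in atTop, ENNReal.ofReal (Real.exp (n * L')) ≤ moment μ q n)
    (h2 : ∀ L' > L, ∀ᶠ n : ℕ in atTop, moment μ q n ≤ ENNReal.ofReal (Real.exp (n * L'))) :
    Tendsto (RSeq A μ q) atTop (𝓝 ((L : ℝ) : EReal)) := by
  refine tendsto_order.2 ⟨fun a ha => ?_, fun a ha => ?_⟩
  · obtain ⟨b, hab, hbL⟩ := EReal.lt_iff_exists_real_btwn.1 ha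
    filter_upwards [h1 b (by exact_mod_cast hbL), eventually_ge_atTop 1] with n hn h1n
    refine hab.trans_le ?_
    rw [← inv_mul_log_ofReal_exp h1n b]
    exact mul_le_mul_of_nonneg_left (ENNReal.log_monotone hn)
      (by exact_mod_cast (by positivity : (0 : ℝ) ≤ (n : ℝ)⁻¹))
  · obtain ⟨b, hLb, hba⟩ := EReal.lt_iff_exists_real_btwn.1 ha
    filter_upwards [h2 b (by exact_mod_cast hLb), eventually_ge_atTop 1] with n hn h1n
    refine lt_of_le_of_lt ?_ hba
    rw [← inv_mul_log_ofReal_exp h1n b]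
    exact mul_le_mul_of_nonneg_left (ENNReal.log_monotone hn)
      (by exact_mod_cast (by positivity : (0 : ℝ) ≤ (n : ℝ)⁻¹))

theorem lintegral_eq_sum_cyl [Nonempty A] (μ : Measure (X A)) (n : ℕ) (f : X A → ENNReal) :
    ∫⁻ x, f x ∂μ = ∑ w : Fin n → A, ∫⁻ x in cyl A w, f x ∂μ := by
  have h : (⋃ w : Fin n → A, cyl A w) = univ :=
    eq_univ_of_forall fun x => mem_iUnion.2 ⟨fun i => x i, fun _ => rfl⟩
  rw [← setLIntegral_univ, ← h, lintegral_iUnion, tsum_fintype]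
  · exact fun w => (isClopen_cyl w).isOpen.measurableSet
  · intro v w hvw
    refine disjoint_left.2 fun x hv hw => hvw (funext fun i => ?_)
    rw [← hv i, hw i]

theorem ofReal_mul_wordSum (μ : Measure (X A)) (s : ℝ) (n : ℕ) {C : ℝ} (hC : 0 ≤ C) :
    ENNReal.ofReal (C * wordSum μ s n) =
      ∑ w : Fin n → A, ENNReal.ofReal (C * μ.real (cyl A w) ^ s) := by
  rw [wordSum, Finset.mul_sum, ENNReal.ofReal_sum_of_nonneg]
  exact fun w _ => mul_nonneg hC (Real.rpow_nonneg measureReal_nonneg s)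

theorem ofReal_mul_wordSum_le {μ : Measure (X A)} [IsFiniteMeasure μ] [Nonempty A]
    {q s C : ℝ} {n : ℕ} (hC : 0 ≤ C)
    (h : ∀ z : X A, ∃ S, MeasurableSet S ∧ S ⊆ box n z ∧ ∃ a, 0 ≤ a ∧
      C * μ.real (box n z) ^ s ≤ a * μ.real S ∧ ∀ x ∈ S, a ≤ (retTime A n x : ℝ) ^ q) :
    ENNReal.ofReal (C * wordSum μ s n) ≤ moment μ q n := by
  rw [moment, lintegral_eq_sum_cyl μ n, ofReal_mul_wordSum μ s n hC]
  refine Finset.sum_le_sum fun w _ => ?_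
  let x : X A := fun _ => Classical.arbitrary A
  rw [cyl_eq_box w x]
  obtain ⟨S, hS, hSz, a, ha, h1, h2⟩ := h (wcat w x)
  calc _ ≤ ENNReal.ofReal (a * μ.real S) := ENNReal.ofReal_le_ofReal h1
    _ = ∫⁻ _ in S, ENNReal.ofReal a ∂μ := by
        rw [setLIntegral_const, ENNReal.ofReal_mul ha, ofReal_measureReal]
    _ ≤ ∫⁻ x in S, ENNReal.ofReal ((retTime A n x : ℝ) ^ q) ∂μ :=
        setLIntegral_mono' hS fun x hx => ENNReal.ofReal_le_ofReal (h2 x hx)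
    _ ≤ _ := lintegral_mono_set hSz

theorem lintegral_le_ofReal_mul_wordSum {μ : Measure (X A)} [Nonempty A] {s C : ℝ} {n : ℕ}
    (hC : 0 ≤ C) {f : X A → ENNReal}
    (h : ∀ z : X A, ∫⁻ x in box n z, f x ∂μ ≤ ENNReal.ofReal (C * μ.real (box n z) ^ s)) :
    ∫⁻ x, f x ∂μ ≤ ENNReal.ofReal (C * wordSum μ s n) := by
  rw [lintegral_eq_sum_cyl μ n, ofReal_mul_wordSum μ s n hC]
  refine Finset.sum_le_sum fun w _ => ?_
  rw [cyl_eq_box w fun _ => Classical.arbitrary A]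
  exact h _

end Growth

section PositiveMoments
variable {A}

theorem exists_mem_avoid {n L : ℕ} (hn : 1 ≤ n) (hL : 1 ≤ L) {z x : X A} (hx : x ∈ box n z) :
    ∃ i : ℕ, retTime A n x ≤ (i + 1) * L * n + 1 ∧
      x ∈ box n z ∩ (shift A)^[n] ⁻¹' avoid n z (i * L) := by
  by_cases h : ∀ N, (shift A)^[n] x ∈ avoid n z N
  · refine ⟨retTime A n x, ?_, hx, h _⟩
    have : 1 ≤ L * n := Nat.mul_pos hL hn
    nlinarith
  push Not at h
  classical
  have hN := Nat.find_spec h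
  have hmin := fun k => Nat.find_min h (m := k)
  set N := Nat.find h
  obtain ⟨j, hj1, hjN, hj⟩ := exists_ret_of_notMem_avoid hx hN
  have hR := retTime_le (Nat.mul_pos hj1 hn) hj
  have hd := Nat.div_add_mod (N - 1) L
  have hm := Nat.mod_lt (N - 1) hL
  refine ⟨(N - 1) / L, ?_, hx, ?_⟩
  · refine hR.trans (Nat.add_le_add_right (Nat.mul_le_mul_right n ?_) 1)
    rw [add_mul, one_mul, mul_comm]
    omega
  · refine not_not.1 (hmin _ ?_)
    rw [mul_comm]
    omega

theorem summable_rpow_mul_exp_neg (q : ℝ) :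
    Summable fun i : ℕ => ((i : ℝ) + 1) ^ q * Real.exp (-i) := by
  obtain ⟨k, hk⟩ := exists_nat_ge q
  have h := (summable_nat_add_iff 1).2 (Real.summable_pow_mul_exp_neg_nat_mul k one_pos)
  refine Summable.of_nonneg_of_le (fun i => by positivity) (fun i => ?_) (h.mul_left (Real.exp 1))
  have h1 : ((i : ℝ) + 1) ^ q ≤ ((i : ℝ) + 1) ^ k := by
    rw [← Real.rpow_natCast]
    exact Real.rpow_le_rpow_of_exponent_le (by linarith [Nat.cast_nonneg (α := ℝ) i]) hk
  have h2 : Real.exp 1 * (((i + 1 : ℕ) : ℝ) ^ k * Real.exp (-1 * (i + 1 : ℕ))) =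
      ((i : ℝ) + 1) ^ k * Real.exp (-i) := by
    rw [mul_left_comm, ← Real.exp_add]
    push_cast
    congr 2; ring
  rw [h2]
  exact mul_le_mul_of_nonneg_right h1 (Real.exp_pos _).le

namespace Equilibrium

variable {φ : X A → ℝ} {μ : Measure (X A)} (H : Equilibrium φ μ)
include H

theorem real_box_le_one (n : ℕ) (z : X A) : μ.real (box n z) ≤ 1 := by
  have := H.isProb
  exact measureReal_le_one

/-- The number of blocks of length `n` after which a point of `box n z` is likely to have
returned. -/
theorem exists_waiting (n : ℕ) (z : X A) : ∃ L : ℕ, 1 ≤ L ∧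
    Real.exp (tail φ 0) / μ.real (box n z) ≤ L ∧
    (L : ℝ) ≤ 2 * Real.exp (tail φ 0) / μ.real (box n z) := by
  have hm := H.real_box_pos n z
  have h1 : 1 ≤ Real.exp (tail φ 0) / μ.real (box n z) := by
    rw [le_div_iff₀ hm, one_mul]
    exact (H.real_box_le_one n z).trans (Real.one_le_exp (H.tail_nonneg 0))
  refine ⟨⌈Real.exp (tail φ 0) / μ.real (box n z)⌉₊, Nat.one_le_iff_ne_zero.2 ?_,
    Nat.le_ceil _, ?_⟩
  · exact (Nat.ceil_pos.2 (by linarith)).ne'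
  · refine (Nat.ceil_lt_add_one (by linarith)).le.trans ?_
    rw [mul_div_assoc]; linarith

theorem moment_le_of_pos {q : ℝ} (hq : 0 < q) : ∃ C, 0 < C ∧ ∀ n : ℕ, 1 ≤ n →
    moment μ q n ≤ ENNReal.ofReal (C * (n : ℝ) ^ q * wordSum μ (1 - q) n) := by
  have := H.isProb
  have := H.nonempty
  set D := tail φ 0 with hD
  set S := ∑' i : ℕ, ((i : ℝ) + 1) ^ q * Real.exp (-i) with hS
  have hsum := summable_rpow_mul_exp_neg q
  have hS0 : 0 < S := hsum.tsum_pos (fun i => by positivity) 0 (by positivity)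
  refine ⟨(4 * Real.exp D) ^ q * Real.exp D * S, by positivity, fun n hn => ?_⟩
  refine lintegral_le_ofReal_mul_wordSum (by positivity) fun z => ?_
  set m := μ.real (box n z) with hm
  have hm0 : 0 < m := H.real_box_pos n z
  have hn' : (1 : ℝ) ≤ n := by exact_mod_cast hn
  obtain ⟨L, hL1, hLge, hLle⟩ := H.exists_waiting n z
  have hL1' : (1 : ℝ) ≤ L := by exact_mod_cast hL1
  set K := 4 * Real.exp D * n / m with hK
  have hK0 : 0 < K := by positivity
  let G : ℕ → Set (X A) := fun i => box n z ∩ (shift A)^[n] ⁻¹' avoid n z (i * L)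
  have hG : ∀ i, MeasurableSet (G i) := fun i =>
    ((isClopen_box n z).inter
      ((isClopen_avoid n z _).preimage (continuous_iterate_shift n))).isOpen.measurableSet
  have hpt : ∀ x ∈ box n z, ENNReal.ofReal ((retTime A n x : ℝ) ^ q) ≤
      ∑' i, (G i).indicator (fun _ => ENNReal.ofReal ((K * ((i : ℝ) + 1)) ^ q)) x := by
    intro x hx
    obtain ⟨i, hi, hxi⟩ := exists_mem_avoid hn hL1 hx
    refine le_trans ?_ (ENNReal.le_tsum i)
    rw [indicator_of_mem hxi]
    refine ENNReal.ofReal_le_ofReal (Real.rpow_le_rpow (Nat.cast_nonneg _) ?_ hq.le)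
    have h1 : (retTime A n x : ℝ) ≤ ((i : ℝ) + 1) * L * n + 1 := by exact_mod_cast hi
    have hi0 : (0 : ℝ) ≤ i := Nat.cast_nonneg i
    have h2 : (1 : ℝ) ≤ ((i : ℝ) + 1) * L * n :=
      one_le_mul_of_one_le_of_one_le (one_le_mul_of_one_le_of_one_le (by linarith) hL1') hn'
    have h3 : ((i : ℝ) + 1) * L * n ≤ ((i : ℝ) + 1) * (2 * Real.exp D / m) * n := by gcongr
    calc (retTime A n x : ℝ) ≤ 2 * (((i : ℝ) + 1) * (2 * Real.exp D / m) * n) := by linarith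
      _ = _ := by rw [hK]; ring
  calc _ ≤ ∫⁻ x in box n z,
        ∑' i, (G i).indicator (fun _ => ENNReal.ofReal ((K * ((i : ℝ) + 1)) ^ q)) x ∂μ :=
        setLIntegral_mono' (isClopen_box n z).isOpen.measurableSet hpt
    _ ≤ ∫⁻ x, ∑' i, (G i).indicator (fun _ => ENNReal.ofReal ((K * ((i : ℝ) + 1)) ^ q)) x ∂μ :=
        setLIntegral_le_lintegral _ _
    _ = ∑' i : ℕ, ENNReal.ofReal ((K * ((i : ℝ) + 1)) ^ q) * μ (G i) := by
        rw [lintegral_tsum fun i => (measurable_const.indicator (hG i)).aemeasurable]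
        exact tsum_congr fun i => lintegral_indicator_const (hG i) _
    _ ≤ ∑' i : ℕ, ENNReal.ofReal
          (K ^ q * (Real.exp D * m) * (((i : ℝ) + 1) ^ q * Real.exp (-i))) := by
        refine ENNReal.tsum_le_tsum fun i => ?_
        rw [← ofReal_measureReal, ← ENNReal.ofReal_mul (by positivity)]
        refine ENNReal.ofReal_le_ofReal ?_
        rw [Real.mul_rpow hK0.le (by positivity)]
        calc _ ≤ K ^ q * ((i : ℝ) + 1) ^ q * (Real.exp D * m * Real.exp (-i)) :=
              mul_le_mul_of_nonneg_left (H.real_box_inter_avoid_le n z i hLge) (by positivity)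
          _ = _ := by ring
    _ = ENNReal.ofReal (K ^ q * (Real.exp D * m) * S) := by
        rw [hS, ← tsum_mul_left, ENNReal.ofReal_tsum_of_nonneg (fun i => by positivity)
          (hsum.mul_left _)]
    _ = _ := by
        congr 1
        rw [hK, Real.div_rpow (by positivity) hm0.le, Real.mul_rpow (by positivity) (by positivity),
          Real.rpow_sub hm0, Real.rpow_one]
        ring

end Equilibrium
end PositiveMoments

section NoEarlyReturn
variable {A}

/-- The next symbol after a word can be chosen to exclude all short return times. -/
theorem exists_symbol_notMem_ret (hcard : 1 < Fintype.card A) {n N : ℕ} (hn : 2 * N ≤ n)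
    (z : X A) : ∃ b : A, ∀ x ∈ box n z, x n = b → ∀ k, 1 ≤ k → k ≤ N → x ∉ ret n k := by
  have := Fintype.one_lt_card_iff_nontrivial.1 hcard
  by_cases h : ∃ p, 1 ≤ p ∧ p ≤ N ∧ ∀ i, i + p < n → z (i + p) = z i
  · obtain ⟨p, hp1, hpN, hp⟩ := h
    obtain ⟨b, hb⟩ := exists_ne (z (n - p))
    refine ⟨b, fun x hx hxb k hk1 hkN hr => hb ?_⟩
    have h1 := hr (n - k) (by omega)
    have h2 := hr (n - k - p) (by omega)
    have h3 := hp (n - k - p) (by omega)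
    rw [show k + (n - k) = n by omega, hxb, hx _ (by omega)] at h1
    rw [show k + (n - k - p) = n - p by omega, hx _ (by omega), hx _ (by omega)] at h2
    rw [show n - k - p + p = n - k by omega] at h3
    rw [h1, h2, h3]
  · push Not at h
    obtain ⟨b⟩ := this.to_nonempty
    refine ⟨b, fun x hx _ k hk1 hkN hr => ?_⟩
    obtain ⟨i, hi, hne⟩ := h k hk1 hkN
    refine hne ?_
    rw [← hx _ hi, ← hx i (by omega), add_comm]
    exact hr i (by omega)

namespace Equilibrium

variable {φ : X A → ℝ} {μ : Measure (X A)} (H : Equilibrium φ μ)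
include H

theorem exists_le_real_box_inter_symbol : ∃ c, 0 < c ∧ ∀ (n : ℕ) (z : X A) (b : A),
    c * μ.real (box n z) ≤ μ.real (box n z ∩ {x | x n = b}) := by
  obtain ⟨B, -, hB⟩ := H.exists_bound
  refine ⟨Real.exp (-tail φ 0) * (Real.exp (-tail φ 0) * Real.exp (-B)), by positivity,
    fun n z b => ?_⟩
  have h1 := H.le_real_box_inter n z (isClopen_box 1 fun _ => b)
  have h2 : box n z ∩ (shift A)^[n] ⁻¹' box 1 (fun _ => b) = box n z ∩ {x | x n = b} := by
    ext x
    simp [box, iterate_shift_apply]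
  rw [h2] at h1
  refine le_trans ?_ h1
  have hm := H.real_box_pos n z
  have h3 := H.le_real_box 1 fun _ => b
  have h4 : Real.exp (-B) ≤ Real.exp (birkhoffSum (shift A) φ 1 fun _ => b) := by
    rw [birkhoffSum_one]
    exact Real.exp_le_exp.2 (neg_le_of_abs_le (hB _))
  calc _ = Real.exp (-tail φ 0) * μ.real (box n z) *
        (Real.exp (-tail φ 0) * Real.exp (-B)) := by ring
    _ ≤ _ := mul_le_mul_of_nonneg_left
        ((mul_le_mul_of_nonneg_left h4 (Real.exp_pos _).le).trans h3) (by positivity)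

/-- Returns at times of intermediate size are unlikely, uniformly over words. -/
theorem exists_sum_real_box_inter_ret_le {ε : ℝ} (hε : 0 < ε) : ∃ N : ℕ, ∀ (n : ℕ) (z : X A),
    μ.real (⋃ k ∈ Finset.Ico (N + 1) n, box n z ∩ ret n k) ≤ ε * μ.real (box n z) := by
  have := H.isProb
  obtain ⟨κ, hκ0, hκ⟩ := H.exists_neg_bound
  set r := Real.exp (-κ) with hr
  have hr0 : 0 < r := Real.exp_pos _
  have hr1 : r < 1 := Real.exp_lt_one_iff.2 (by linarith)
  have hlim : Tendsto (fun N : ℕ => Real.exp (tail φ 0) * (Real.exp (tail φ 0) *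
      (r ^ (N + 1) / (1 - r)))) atTop (𝓝 0) := by
    have h := (((tendsto_pow_atTop_nhds_zero_of_lt_one hr0.le hr1).comp
      (tendsto_add_atTop_nat 1)).div_const (1 - r)).const_mul (Real.exp (tail φ 0))
      |>.const_mul (Real.exp (tail φ 0))
    simpa using h
  obtain ⟨N, hN⟩ := (hlim.eventually_lt_const hε).exists
  refine ⟨N, fun n z => ?_⟩
  have hm := H.real_box_pos n z
  refine (measureReal_biUnion_finset_le _ _).trans ?_
  calc _ ≤ ∑ k ∈ Finset.Ico (N + 1) n,
        Real.exp (tail φ 0) * μ.real (box n z) * (Real.exp (tail φ 0) * r ^ k) :=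
        Finset.sum_le_sum fun k hk =>
          H.real_box_inter_ret_le_exp hκ (Finset.mem_Ico.1 hk).2.le z
    _ = Real.exp (tail φ 0) * μ.real (box n z) *
        (Real.exp (tail φ 0) * ∑ k ∈ Finset.Ico (N + 1) n, r ^ k) := by
        rw [← Finset.mul_sum, ← Finset.mul_sum]
    _ ≤ Real.exp (tail φ 0) * μ.real (box n z) *
        (Real.exp (tail φ 0) * (r ^ (N + 1) / (1 - r))) := by
        have := geom_sum_Ico_le_of_lt_one (m := N + 1) (n := n) hr0.le hr1
        gcongr
    _ = Real.exp (tail φ 0) * (Real.exp (tail φ 0) * (r ^ (N + 1) / (1 - r))) *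
        μ.real (box n z) := by ring
    _ ≤ _ := mul_le_mul_of_nonneg_right hN.le hm.le

theorem exists_exp_mul_exp_neg_le {ε : ℝ} (hε : 0 < ε) :
    ∃ i : ℕ, Real.exp (tail φ 0) * Real.exp (-i) ≤ ε := by
  have h := (Real.tendsto_exp_neg_atTop_nhds_zero.comp
    tendsto_natCast_atTop_atTop).const_mul (Real.exp (tail φ 0))
  rw [mul_zero] at h
  obtain ⟨i, hi⟩ := (h.eventually_lt_const hε).exists
  exact ⟨i, hi.le⟩

/-- A definite proportion of every cylinder takes at least a time of the order of the inverse of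
its measure to return. -/
theorem exists_late_return : ∃ c, 0 < c ∧ ∃ n₀ : ℕ, ∀ n, n₀ ≤ n → ∀ z : X A,
    ∃ S, MeasurableSet S ∧ S ⊆ box n z ∧ c * μ.real (box n z) ≤ μ.real S ∧
      ∀ x ∈ S, c / μ.real (box n z) ≤ retTime A n x := by
  have := H.isProb
  obtain ⟨c, hc, hsymb⟩ := H.exists_le_real_box_inter_symbol
  obtain ⟨N, hN⟩ := H.exists_sum_real_box_inter_ret_le (ε := c / 4) (by positivity)
  obtain ⟨i₀, hi₀⟩ := H.exists_exp_mul_exp_neg_le (ε := c / 4) (by positivity)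
  set D := tail φ 0 with hD
  have hD1 : 1 ≤ Real.exp D := Real.one_le_exp (H.tail_nonneg 0)
  refine ⟨c / (4 * Real.exp D), by positivity, 2 * N + 1, fun n hn z => ?_⟩
  obtain ⟨b, hb⟩ := exists_symbol_notMem_ret H.card (n := n) (N := N) (by omega) z
  set m := μ.real (box n z) with hm
  have hm0 : 0 < m := H.real_box_pos n z
  obtain ⟨L, hL1, hLge, hLle⟩ := H.exists_waiting n z
  set T := c / (4 * Real.exp D) / m with hT
  have hT0 : 0 < T := by positivity
  set E := box n z ∩ {x : X A | x n = b} with hE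
  set U₁ := ⋃ k ∈ Finset.Ico (N + 1) n, box n z ∩ ret n k with hU₁
  set U₂ := ⋃ k ∈ Finset.Ico n (⌊T⌋₊ + 1), box n z ∩ ret n k with hU₂
  set U₃ := box n z ∩ (shift A)^[n] ⁻¹' avoid n z (i₀ * L) with hU₃
  have hbox := (isClopen_box n z).isOpen.measurableSet
  have hret : ∀ k, MeasurableSet (box n z ∩ ret n k) := fun k =>
    hbox.inter (isClopen_ret n k).isOpen.measurableSet
  have hEm : MeasurableSet E := hbox.inter (isClopen_coord_eq n b).isOpen.measurableSet
  have hU₁m : MeasurableSet U₁ := Finset.measurableSet_biUnion _ fun k _ => hret k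
  have hU₂m : MeasurableSet U₂ := Finset.measurableSet_biUnion _ fun k _ => hret k
  have hU₃m : MeasurableSet U₃ := hbox.inter
    ((isClopen_avoid n z _).preimage (continuous_iterate_shift n)).isOpen.measurableSet
  have h1 : μ.real U₁ ≤ c / 4 * m := hN n z
  have h2 : μ.real U₂ ≤ c / 4 * m := by
    refine (measureReal_biUnion_finset_le _ _).trans ?_
    refine (Finset.sum_le_card_nsmul _ _ (Real.exp D * m * m) fun k hk =>
      H.real_box_inter_ret_le (Finset.mem_Ico.1 hk).1 z).trans ?_
    rw [Nat.card_Ico, nsmul_eq_mul]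
    have h3 : ((⌊T⌋₊ + 1 - n : ℕ) : ℝ) ≤ T :=
      (Nat.cast_le.2 (by omega)).trans (Nat.floor_le hT0.le)
    calc _ ≤ T * (Real.exp D * m * m) := mul_le_mul_of_nonneg_right h3 (by positivity)
      _ = _ := by rw [hT]; field_simp
  have h3 : μ.real U₃ ≤ c / 4 * m := by
    refine (H.real_box_inter_avoid_le n z i₀ hLge).trans ?_
    rw [mul_right_comm]
    exact mul_le_mul_of_nonneg_right hi₀ hm0.le
  refine ⟨E \ (U₁ ∪ U₂ ∪ U₃), hEm.diff ((hU₁m.union hU₂m).union hU₃m),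
    fun x hx => hx.1.1, ?_, fun x hx => ?_⟩
  · have h4 := le_measureReal_sdiff (μ := μ) (s₁ := E) (s₂ := U₁ ∪ U₂ ∪ U₃)
    have h5 := measureReal_union_le (μ := μ) (U₁ ∪ U₂) U₃
    have h6 := measureReal_union_le (μ := μ) U₁ U₂
    have h7 : c / (4 * Real.exp D) ≤ c / 4 :=
      div_le_div_of_nonneg_left hc.le (by norm_num) (by linarith)
    have h8 := mul_le_mul_of_nonneg_right h7 hm0.le
    have h9 : c * m ≤ μ.real E := hsymb n z b
    linarith
  · have hxz : x ∈ box n z := hx.1.1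
    have hxU : x ∉ U₁ ∧ x ∉ U₂ ∧ x ∉ U₃ := by
      have := hx.2
      simp only [mem_union, not_or] at this
      tauto
    obtain ⟨hx1, hx2, hx3⟩ := hxU
    obtain ⟨j, hj1, -, hj⟩ := exists_ret_of_notMem_avoid hxz fun h => hx3 ⟨hxz, h⟩
    obtain ⟨k, hk1, hRk, hk⟩ := exists_retTime_eq (Nat.mul_pos hj1 (by omega)) hj
    have hkN : N < k := by
      by_contra! h
      exact hb x hxz hx.1.2 k hk1 h hk
    have hkn : n ≤ k := by
      by_contra! h
      exact hx1 (mem_biUnion (Finset.mem_Ico.2 ⟨hkN, h⟩) ⟨hxz, hk⟩)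
    have hkT : ⌊T⌋₊ + 1 ≤ k := by
      by_contra! h
      exact hx2 (mem_biUnion (Finset.mem_Ico.2 ⟨hkn, h⟩) ⟨hxz, hk⟩)
    rw [hRk]
    refine (Nat.lt_floor_add_one T).le.trans ?_
    exact_mod_cast hkT.trans (Nat.le_succ k)

theorem le_moment_of_pos {q : ℝ} (hq : 0 < q) : ∃ C, 0 < C ∧ ∃ n₀ : ℕ, ∀ n, n₀ ≤ n →
    ENNReal.ofReal (C * wordSum μ (1 - q) n) ≤ moment μ q n := by
  have := H.isProb
  have := H.nonempty
  obtain ⟨c, hc, n₀, h⟩ := H.exists_late_return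
  refine ⟨c ^ q * c, by positivity, n₀, fun n hn => ?_⟩
  refine ofReal_mul_wordSum_le (by positivity) fun z => ?_
  obtain ⟨S, hS, hSz, h1, h2⟩ := h n hn z
  have hm := H.real_box_pos n z
  refine ⟨S, hS, hSz, (c / μ.real (box n z)) ^ q, by positivity, ?_, fun x hx =>
    Real.rpow_le_rpow (by positivity) (h2 x hx) hq.le⟩
  calc _ = (c / μ.real (box n z)) ^ q * (c * μ.real (box n z)) := by
        rw [Real.div_rpow hc.le hm.le, Real.rpow_sub hm, Real.rpow_one]; ring
    _ ≤ _ := mul_le_mul_of_nonneg_left h1 (by positivity)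

end Equilibrium
end NoEarlyReturn

section NegativeMoments
variable {A}

theorem sum_rpow_le {q : ℝ} (hq : -1 < q) (hq0 : q < 0) (N : ℕ) :
    ∑ k ∈ Finset.Ico 1 (N + 1), (k : ℝ) ^ q ≤ (N : ℝ) ^ (1 + q) / (1 + q) := by
  have hp : 0 < 1 + q := by linarith
  rw [le_div_iff₀ hp]
  induction N with
  | zero => simp [Real.zero_rpow hp.ne']
  | succ N ih =>
    rw [Finset.sum_Ico_succ_top (by omega), add_mul]
    have ht : (0 : ℝ) < (N : ℝ) + 1 := by positivity
    have h1 := rpow_one_add_le_one_add_mul_self (s := -(1 / ((N : ℝ) + 1)))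
      (by rw [neg_le_neg_iff, div_le_one ht]; linarith [Nat.cast_nonneg (α := ℝ) N]) hp.le
      (by linarith)
    have h2 : 1 + -(1 / ((N : ℝ) + 1)) = N / ((N : ℝ) + 1) := by field_simp; ring
    rw [h2, Real.div_rpow (Nat.cast_nonneg N) ht.le, div_le_iff₀ (by positivity)] at h1
    have h3 : ((N : ℝ) + 1) ^ (1 + q) = ((N : ℝ) + 1) * ((N : ℝ) + 1) ^ q := by
      rw [Real.rpow_add ht, Real.rpow_one]
    have h4 : (1 + (1 + q) * -(1 / ((N : ℝ) + 1))) * ((N : ℝ) + 1) ^ (1 + q) =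
        ((N : ℝ) + 1) ^ (1 + q) - (1 + q) * ((N : ℝ) + 1) ^ q := by
      rw [h3]; field_simp; ring
    push_cast
    linarith

theorem birkhoffSum_mul_periodize (φ : X A → ℝ) (K j : ℕ) (z : X A) :
    birkhoffSum (shift A) φ (j * K) (periodize K z) =
      j * birkhoffSum (shift A) φ K (periodize K z) := by
  induction j with
  | zero => simp
  | succ j ih =>
    rw [Nat.succ_mul, add_comm, birkhoffSum_add, iterate_shift_periodize, ih]
    push_cast; ring

theorem two_le_retTime {n k : ℕ} {x : X A} (hk : 1 ≤ k) (h : x ∈ ret n k) :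
    2 ≤ retTime A n x := by
  obtain ⟨j, hj, h, -⟩ := exists_retTime_eq hk h
  omega

namespace Equilibrium

variable {φ : X A → ℝ} {μ : Measure (X A)} (H : Equilibrium φ μ)
include H

theorem le_moment_of_nonpos {q : ℝ} (hq : q ≤ 0) : ∃ C, 0 < C ∧ ∀ n : ℕ, 1 ≤ n →
    ENNReal.ofReal (C * (n : ℝ) ^ q * wordSum μ (1 - q) n) ≤ moment μ q n := by
  have := H.isProb
  have := H.nonempty
  obtain ⟨i, hi⟩ := H.exists_exp_mul_exp_neg_le (ε := 1 / 2) (by norm_num)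
  set K := ((i : ℝ) + 1) * (2 * Real.exp (tail φ 0)) with hK
  have hK0 : 0 < K := by positivity
  refine ⟨K ^ q / 2, by positivity, fun n hn => ?_⟩
  refine ofReal_mul_wordSum_le (by positivity) fun z => ?_
  have hn' : (1 : ℝ) ≤ n := by exact_mod_cast hn
  set m := μ.real (box n z) with hm
  have hm0 : 0 < m := H.real_box_pos n z
  obtain ⟨L, hL1, hLge, hLle⟩ := H.exists_waiting n z
  have hL1' : (1 : ℝ) ≤ L := by exact_mod_cast hL1
  set U := box n z ∩ (shift A)^[n] ⁻¹' avoid n z (i * L) with hU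
  have hUm : MeasurableSet U := ((isClopen_box n z).inter
    ((isClopen_avoid n z _).preimage (continuous_iterate_shift n))).isOpen.measurableSet
  have hUle : μ.real U ≤ 1 / 2 * m := by
    refine (H.real_box_inter_avoid_le n z i hLge).trans ?_
    rw [mul_right_comm]
    exact mul_le_mul_of_nonneg_right hi hm0.le
  refine ⟨box n z \ U, (isClopen_box n z).isOpen.measurableSet.diff hUm, sdiff_subset,
    (K * n / m) ^ q, by positivity, ?_, fun x hx => ?_⟩
  · have h1 := le_measureReal_sdiff (μ := μ) (s₁ := box n z) (s₂ := U)
    have h2 : m / 2 ≤ μ.real (box n z \ U) := by linarith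
    calc _ = (K * n / m) ^ q * (m / 2) := by
          rw [Real.div_rpow (by positivity) hm0.le, Real.mul_rpow hK0.le (by positivity),
            Real.rpow_sub hm0, Real.rpow_one]
          ring
      _ ≤ _ := mul_le_mul_of_nonneg_left h2 (by positivity)
  · obtain ⟨j, hj1, hjN, hj⟩ := exists_ret_of_notMem_avoid hx.1 fun h => hx.2 ⟨hx.1, h⟩
    have hjn : 1 ≤ j * n := Nat.mul_pos hj1 hn
    have hR2 := two_le_retTime hjn hj
    refine Real.rpow_le_rpow_of_nonpos (by positivity) ?_ hq
    have h1 : retTime A n x ≤ i * L * n + 1 :=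
      (retTime_le hjn hj).trans (Nat.add_le_add_right (Nat.mul_le_mul_right n hjN) 1)
    have h2 : (retTime A n x : ℝ) ≤ (i : ℝ) * L * n + 1 := by exact_mod_cast h1
    have h3 : (1 : ℝ) ≤ L * n := one_le_mul_of_one_le_of_one_le hL1' hn'
    calc (retTime A n x : ℝ) ≤ ((i : ℝ) + 1) * L * n := by linarith
      _ ≤ ((i : ℝ) + 1) * (2 * Real.exp (tail φ 0) / m) * n := by gcongr
      _ = _ := by rw [hK]; ring

/-- Points close to a periodic orbit return quickly. -/
theorem le_moment_of_nonpos' {q : ℝ} (hq : q ≤ 0) {K : ℕ} (hK : 1 ≤ K) : ∃ C, 0 < C ∧ ∀ n : ℕ,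
    ENNReal.ofReal (C * Real.exp (n * (supInt A φ - tail φ 0 / K))) ≤ moment μ q n := by
  have := H.isProb
  obtain ⟨z, hz⟩ := H.exists_le_birkhoffSum K
  have hK' : (0 : ℝ) < K := by exact_mod_cast hK
  set D := tail φ 0 with hD
  set γ := supInt A φ with hγ
  have hneg : K * γ - D < 0 := by
    have h1 := H.tail_nonneg 0
    have h2 := mul_neg_of_pos_of_neg hK' H.supInt_neg
    linarith
  refine ⟨((K : ℝ) + 1) ^ q * (Real.exp (-D) * Real.exp (2 * (K * γ - D))), by positivity,
    fun n => ?_⟩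
  set y := periodize K z with hy
  set j := n / K + 2 with hj
  have hjK : n + K ≤ j * K := by
    have h1 := Nat.div_add_mod n K
    have h2 := Nat.mod_lt n hK
    rw [hj, add_mul, mul_comm]; omega
  have hsub : ∀ x ∈ box (j * K) y, x ∈ ret n K := by
    intro x hx i hi
    rw [hx _ (by omega), hx i (by omega), hy, periodize, periodize, Nat.add_mod_left]
  have hS : (n : ℝ) * (γ - D / K) + 2 * (K * γ - D) ≤ birkhoffSum (shift A) φ (j * K) y := by
    rw [hy, birkhoffSum_mul_periodize]
    have h1 := H.birkhoffSum_le_add (n := K) (x := z) (y := periodize K z)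
      fun i hi => (periodize_of_lt z hi).symm
    have h2 : (j : ℝ) ≤ n / K + 2 := by
      rw [hj]; push_cast
      linarith [Nat.cast_div_le (α := ℝ) (m := n) (n := K)]
    calc _ = ((n : ℝ) / K + 2) * (K * γ - D) := by field_simp
      _ ≤ j * (K * γ - D) := mul_le_mul_of_nonpos_right h2 hneg.le
      _ ≤ _ := mul_le_mul_of_nonneg_left (by linarith) (Nat.cast_nonneg j)
  calc _ ≤ ENNReal.ofReal (((K : ℝ) + 1) ^ q * μ.real (box (j * K) y)) := by
        refine ENNReal.ofReal_le_ofReal ?_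
        rw [mul_assoc]
        refine mul_le_mul_of_nonneg_left ?_ (by positivity)
        refine le_trans ?_ (H.le_real_box _ _)
        rw [mul_assoc, ← Real.exp_add]
        refine mul_le_mul_of_nonneg_left (Real.exp_le_exp.2 ?_) (Real.exp_pos _).le
        linarith
    _ = ∫⁻ _ in box (j * K) y, ENNReal.ofReal (((K : ℝ) + 1) ^ q) ∂μ := by
        rw [setLIntegral_const, ENNReal.ofReal_mul (by positivity), ofReal_measureReal]
    _ ≤ ∫⁻ x in box (j * K) y, ENNReal.ofReal ((retTime A n x : ℝ) ^ q) ∂μ := by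
        refine setLIntegral_mono' (isClopen_box _ _).isOpen.measurableSet fun x hx =>
          ENNReal.ofReal_le_ofReal ?_
        have h1 := two_le_retTime hK (hsub x hx)
        refine Real.rpow_le_rpow_of_nonpos (by positivity) ?_ hq
        exact_mod_cast retTime_le hK (hsub x hx)
    _ ≤ _ := setLIntegral_le_lintegral _ _

theorem setLIntegral_rpow_retTime_le {q : ℝ} (hq : -1 < q) (hq0 : q < 0) {n : ℕ} (hn : 1 ≤ n)
    (z : X A) :
    ∫⁻ x in box n z, (⋃ k ∈ Finset.Ico 1 n, ret n k)ᶜ.indicator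
      (fun x => ENNReal.ofReal ((retTime A n x : ℝ) ^ q)) x ∂μ ≤
      ENNReal.ofReal ((Real.exp (tail φ 0) * (2 ^ (1 + q) / (1 + q)) + 1) *
        μ.real (box n z) ^ (1 - q)) := by
  have := H.isProb
  have hp : 0 < 1 + q := by linarith
  set m := μ.real (box n z) with hm
  have hm0 : 0 < m := H.real_box_pos n z
  have hm1 : 1 ≤ 1 / m := by rw [le_div_iff₀ hm0, one_mul]; exact H.real_box_le_one n z
  set N := ⌈1 / m⌉₊ with hN
  have hNge : 1 / m ≤ N := Nat.le_ceil _
  have hNle : (N : ℝ) ≤ 2 / m := by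
    refine (Nat.ceil_lt_add_one (by linarith)).le.trans ?_
    rw [show 2 / m = 1 / m + 1 / m by ring]; linarith
  have hret : ∀ k, MeasurableSet (box n z ∩ ret n k) := fun k =>
    (isClopen_box n z).isOpen.measurableSet.inter (isClopen_ret n k).isOpen.measurableSet
  have hpt : ∀ x ∈ box n z, (⋃ k ∈ Finset.Ico 1 n, ret n k)ᶜ.indicator
      (fun x => ENNReal.ofReal ((retTime A n x : ℝ) ^ q)) x ≤
      (∑ k ∈ Finset.Ico n (N + 1),
        (box n z ∩ ret n k).indicator (fun _ => ENNReal.ofReal ((k : ℝ) ^ q)) x) +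
        ENNReal.ofReal ((N : ℝ) ^ q) := by
    intro x hx
    by_cases hxr : ∃ k, 1 ≤ k ∧ x ∈ ret n k
    · obtain ⟨k, hk, hkr⟩ := hxr
      obtain ⟨j, hj1, hjR, hj⟩ := exists_retTime_eq hk hkr
      have hR : ∀ {a : ℕ}, 1 ≤ a → a ≤ j →
          ENNReal.ofReal ((retTime A n x : ℝ) ^ q) ≤ ENNReal.ofReal ((a : ℝ) ^ q) := by
        intro a ha haj
        refine ENNReal.ofReal_le_ofReal (Real.rpow_le_rpow_of_nonpos (by positivity) ?_ hq0.le)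
        rw [hjR]; exact_mod_cast haj.trans (Nat.le_succ j)
      by_cases hjn : j < n
      · rw [indicator_of_notMem (not_not.2 (mem_biUnion (Finset.mem_Ico.2 ⟨hj1, hjn⟩) hj))]
        exact zero_le
      refine (indicator_le_self _ _ x).trans ?_
      by_cases hjN : j < N + 1
      · refine le_trans ?_ le_self_add
        refine le_trans ?_ (Finset.single_le_sum (fun _ _ => zero_le)
          (Finset.mem_Ico.2 ⟨not_lt.1 hjn, hjN⟩))
        rw [indicator_of_mem (show x ∈ box n z ∩ ret n j from ⟨hx, hj⟩)]
        exact hR hj1 le_rfl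
      · refine le_trans ?_ le_add_self
        exact hR (Nat.one_le_iff_ne_zero.2 (Nat.ceil_pos.2 (by linarith)).ne') (by omega)
    · push Not at hxr
      refine (indicator_le_self _ _ x).trans ?_
      rw [retTime_eq_zero hxr, Nat.cast_zero, Real.zero_rpow hq0.ne, ENNReal.ofReal_zero]
      exact zero_le
  refine (setLIntegral_mono' (isClopen_box n z).isOpen.measurableSet hpt).trans ?_
  rw [lintegral_add_right _ measurable_const, setLIntegral_const]
  have h1 : ∫⁻ x in box n z, ∑ k ∈ Finset.Ico n (N + 1),
      (box n z ∩ ret n k).indicator (fun _ => ENNReal.ofReal ((k : ℝ) ^ q)) x ∂μ ≤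
      ENNReal.ofReal (Real.exp (tail φ 0) * m * m * ((2 / m) ^ (1 + q) / (1 + q))) := by
    refine (setLIntegral_le_lintegral _ _).trans ?_
    rw [lintegral_finsetSum _ fun k _ => measurable_const.indicator (hret k)]
    calc _ ≤ ∑ k ∈ Finset.Ico n (N + 1),
          ENNReal.ofReal (Real.exp (tail φ 0) * m * m * (k : ℝ) ^ q) := by
          refine Finset.sum_le_sum fun k hk => ?_
          rw [lintegral_indicator_const (hret k), ← ofReal_measureReal,
            ← ENNReal.ofReal_mul (by positivity), mul_comm]
          exact ENNReal.ofReal_le_ofReal (mul_le_mul_of_nonneg_right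
            (H.real_box_inter_ret_le (Finset.mem_Ico.1 hk).1 z) (by positivity))
      _ = ENNReal.ofReal (Real.exp (tail φ 0) * m * m * ∑ k ∈ Finset.Ico n (N + 1),
          (k : ℝ) ^ q) := by
          rw [Finset.mul_sum, ENNReal.ofReal_sum_of_nonneg fun k _ => by positivity]
      _ ≤ _ := by
          refine ENNReal.ofReal_le_ofReal (mul_le_mul_of_nonneg_left ?_ (by positivity))
          calc _ ≤ ∑ k ∈ Finset.Ico 1 (N + 1), (k : ℝ) ^ q :=
                Finset.sum_le_sum_of_subset_of_nonneg (Finset.Ico_subset_Ico_left hn)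
                  fun k _ _ => by positivity
            _ ≤ (N : ℝ) ^ (1 + q) / (1 + q) := sum_rpow_le hq hq0 N
            _ ≤ _ := by gcongr
  have h2 : ENNReal.ofReal ((N : ℝ) ^ q) * μ (box n z) ≤ ENNReal.ofReal ((1 / m) ^ q * m) := by
    rw [ENNReal.ofReal_mul (by positivity), hm, ofReal_measureReal, ← hm]
    exact mul_le_mul_left (ENNReal.ofReal_le_ofReal
      (Real.rpow_le_rpow_of_nonpos (by positivity) hNge hq0.le)) _
  refine (add_le_add h1 h2).trans_eq ?_
  rw [← ENNReal.ofReal_add (by positivity) (by positivity)]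
  congr 1
  rw [Real.div_rpow zero_le_two hm0.le, Real.div_rpow zero_le_one hm0.le, Real.one_rpow,
    Real.rpow_add hm0, Real.rpow_sub hm0, Real.rpow_one]
  field_simp

theorem moment_le_of_neg {q : ℝ} (hq : -1 < q) (hq0 : q < 0) : ∃ C, 0 < C ∧ ∀ n : ℕ, 1 ≤ n →
    moment μ q n ≤ ENNReal.ofReal (n * Real.exp (3 * tail φ 0 + n * supInt A φ) +
      C * wordSum μ (1 - q) n) := by
  have := H.isProb
  have := H.nonempty
  have hp : 0 < 1 + q := by linarith
  refine ⟨Real.exp (tail φ 0) * (2 ^ (1 + q) / (1 + q)) + 1, by positivity, fun n hn => ?_⟩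
  set U : Set (X A) := ⋃ k ∈ Finset.Ico 1 n, ret n k with hU
  have hUm : MeasurableSet U := Finset.measurableSet_biUnion _ fun k _ =>
    (isClopen_ret n k).isOpen.measurableSet
  have hw := (H.wordSum_pos (1 - q) n).le
  have h1 : μ.real U ≤ n * Real.exp (3 * tail φ 0 + n * supInt A φ) := by
    refine (measureReal_biUnion_finset_le _ _).trans ?_
    refine (Finset.sum_le_card_nsmul _ _ _ fun k hk =>
      H.real_ret_le (Finset.mem_Ico.1 hk).1).trans ?_
    rw [Nat.card_Ico, nsmul_eq_mul]
    exact mul_le_mul_of_nonneg_right (Nat.cast_le.2 (Nat.sub_le n 1)) (Real.exp_pos _).le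
  rw [ENNReal.ofReal_add (by positivity) (by positivity)]
  calc moment μ q n ≤ ∫⁻ x, U.indicator (fun _ => 1) x + Uᶜ.indicator
        (fun x => ENNReal.ofReal ((retTime A n x : ℝ) ^ q)) x ∂μ := by
        refine lintegral_mono fun x => ?_
        by_cases hx : x ∈ U
        · rw [indicator_of_mem hx, indicator_of_notMem (not_not.2 hx), add_zero]
          refine ENNReal.ofReal_le_one.2 ?_
          obtain ⟨k, hk, hxk⟩ := mem_iUnion₂.1 hx
          have := two_le_retTime (Finset.mem_Ico.1 hk).1 hxk
          exact Real.rpow_le_one_of_one_le_of_nonpos (by exact_mod_cast (by omega)) hq0.le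
        · rw [indicator_of_notMem hx, indicator_of_mem (show x ∈ Uᶜ from hx), zero_add]
    _ = μ U + ∫⁻ x, Uᶜ.indicator
        (fun x => ENNReal.ofReal ((retTime A n x : ℝ) ^ q)) x ∂μ := by
        rw [lintegral_add_left (measurable_const.indicator hUm), lintegral_indicator_const hUm,
          one_mul]
    _ ≤ _ := by
        refine add_le_add ?_ (lintegral_le_ofReal_mul_wordSum (by positivity) fun z =>
          H.setLIntegral_rpow_retTime_le hq hq0 hn z)
        rw [← ofReal_measureReal (measure_ne_top μ U)]
        exact ENNReal.ofReal_le_ofReal h1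

end Equilibrium
end NegativeMoments

section Spectrum
variable {A}

namespace Equilibrium

variable {φ : X A → ℝ} {μ : Measure (X A)} (H : Equilibrium φ μ)
include H

theorem eventually_le_moment {q s C p : ℝ} (hC : 0 < C)
    (h : ∀ᶠ n : ℕ in atTop, ENNReal.ofReal (C * (n : ℝ) ^ p * wordSum μ s n) ≤ moment μ q n)
    {L : ℝ} (hL : L < pressure A fun x => s * φ x) :
    ∀ᶠ n : ℕ in atTop, ENNReal.ofReal (Real.exp (n * L)) ≤ moment μ q n := by
  have hpos : ∀ᶠ n : ℕ in atTop, 0 < C * (n : ℝ) ^ p * wordSum μ s n := by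
    filter_upwards [eventually_ge_atTop 1] with n hn
    have := H.wordSum_pos s n
    positivity
  filter_upwards [h, eventually_exp_le hpos (tendsto_log_const_mul_rpow_mul (H.wordSum_pos s)
    (H.tendsto_pressure s) hC p) hL] with n h1 h2
  exact (ENNReal.ofReal_le_ofReal h2).trans h1

theorem eventually_moment_le {q s C p : ℝ} (hC : 0 < C)
    (h : ∀ᶠ n : ℕ in atTop, moment μ q n ≤ ENNReal.ofReal (C * (n : ℝ) ^ p * wordSum μ s n))
    {L : ℝ} (hL : (pressure A fun x => s * φ x) < L) :
    ∀ᶠ n : ℕ in atTop, moment μ q n ≤ ENNReal.ofReal (Real.exp (n * L)) := by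
  have hpos : ∀ᶠ n : ℕ in atTop, 0 < C * (n : ℝ) ^ p * wordSum μ s n := by
    filter_upwards [eventually_ge_atTop 1] with n hn
    have := H.wordSum_pos s n
    positivity
  filter_upwards [h, eventually_le_exp hpos (tendsto_log_const_mul_rpow_mul (H.wordSum_pos s)
    (H.tendsto_pressure s) hC p) hL] with n h1 h2
  exact h1.trans (ENNReal.ofReal_le_ofReal h2)

theorem eventually_le_moment_of_lt_supInt {q : ℝ} (hq : q ≤ 0) {L : ℝ} (hL : L < supInt A φ) :
    ∀ᶠ n : ℕ in atTop, ENNReal.ofReal (Real.exp (n * L)) ≤ moment μ q n := by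
  have hlim : Tendsto (fun K : ℕ => supInt A φ - tail φ 0 / K) atTop (𝓝 (supInt A φ)) := by
    simpa using (tendsto_const_div_atTop_nhds_zero_nat (tail φ 0)).const_sub (supInt A φ)
  obtain ⟨K, hK, hK1⟩ := ((hlim.eventually_const_lt hL).and (eventually_ge_atTop 1)).exists
  obtain ⟨C, hC, h⟩ := H.le_moment_of_nonpos' hq hK1
  set a := supInt A φ - tail φ 0 / K
  have h1 : Tendsto (fun n : ℕ => Real.log (Real.exp (n * a)) / n) atTop (𝓝 a) := by
    refine tendsto_const_nhds.congr' ?_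
    filter_upwards [eventually_ge_atTop 1] with n hn
    rw [Real.log_exp, mul_div_cancel_left₀ _ (by positivity)]
  have h2 := tendsto_log_const_mul_rpow_mul (fun n => Real.exp_pos (n * a)) h1 hC 0
  simp only [Real.rpow_zero, mul_one] at h2
  filter_upwards [eventually_exp_le (Eventually.of_forall fun n => by positivity) h2 hK] with n hn
  exact (ENNReal.ofReal_le_ofReal hn).trans (h n)

theorem tendsto_RSeq_zero : Tendsto (RSeq A μ 0) atTop (𝓝 ((0 : ℝ) : EReal)) := by
  have := H.isProb
  refine tendsto_const_nhds.congr fun n => ?_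
  simp [RSeq]

theorem tendsto_RSeq_of_pos {q : ℝ} (hq : 0 < q) : Tendsto (RSeq A μ q) atTop
    (𝓝 ((pressure A fun x => (1 - q) * φ x : ℝ) : EReal)) := by
  obtain ⟨C, hC, n₀, h⟩ := H.le_moment_of_pos hq
  obtain ⟨C', hC', h'⟩ := H.moment_le_of_pos hq
  refine tendsto_RSeq (fun L hL => H.eventually_le_moment (p := 0) hC ?_ hL)
    fun L hL => H.eventually_moment_le hC' (eventually_atTop.2 ⟨1, h'⟩) hL
  filter_upwards [eventually_ge_atTop n₀] with n hn
  simpa using h n hn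

theorem eventually_moment_le_of_neg {q : ℝ} (hq : -1 < q) (hq0 : q < 0)
    (hγ : supInt A φ ≤ pressure A fun x => (1 - q) * φ x) {L : ℝ}
    (hL : (pressure A fun x => (1 - q) * φ x) < L) :
    ∀ᶠ n : ℕ in atTop, moment μ q n ≤ ENNReal.ofReal (Real.exp (n * L)) := by
  obtain ⟨C, hC, h⟩ := H.moment_le_of_neg hq hq0
  set c := Real.exp (3 * tail φ 0) * Real.exp (|1 - q| * tail φ 0) with hc
  refine H.eventually_moment_le (s := 1 - q) (C := c + C) (p := 1) (by positivity) ?_ hL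
  filter_upwards [eventually_ge_atTop 1] with n hn
  refine (h n hn).trans (ENNReal.ofReal_le_ofReal ?_)
  have hn' : (1 : ℝ) ≤ n := by exact_mod_cast hn
  have hw := H.wordSum_pos (1 - q) n
  have h1 : Real.exp (n * supInt A φ) ≤
      Real.exp (|1 - q| * tail φ 0) * wordSum μ (1 - q) n :=
    (Real.exp_le_exp.2 (mul_le_mul_of_nonneg_left hγ (by positivity))).trans
      (H.exp_pressure_le (1 - q) n)
  have h2 : C * wordSum μ (1 - q) n ≤ C * n * wordSum μ (1 - q) n :=
    mul_le_mul_of_nonneg_right (le_mul_of_one_le_right hC.le hn') hw.le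
  rw [Real.exp_add, Real.rpow_one]
  calc _ ≤ n * (Real.exp (3 * tail φ 0) * (Real.exp (|1 - q| * tail φ 0) *
        wordSum μ (1 - q) n)) + C * n * wordSum μ (1 - q) n := by gcongr
    _ = _ := by rw [hc]; ring

theorem tendsto_RSeq_of_neg {q : ℝ} (hq : -1 < q) (hq0 : q < 0)
    (hγ : supInt A φ ≤ pressure A fun x => (1 - q) * φ x) : Tendsto (RSeq A μ q) atTop
    (𝓝 ((pressure A fun x => (1 - q) * φ x : ℝ) : EReal)) := by
  obtain ⟨C, hC, h⟩ := H.le_moment_of_nonpos hq0.le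
  exact tendsto_RSeq (fun L hL => H.eventually_le_moment hC (eventually_atTop.2 ⟨1, h⟩) hL)
    fun L hL => H.eventually_moment_le_of_neg hq hq0 hγ hL

end Equilibrium

theorem moment_mono {μ : Measure (X A)} {q q' : ℝ} (h : q ≤ q') (hq' : q' < 0) (n : ℕ) :
    moment μ q n ≤ moment μ q' n := by
  refine lintegral_mono fun x => ENNReal.ofReal_le_ofReal ?_
  rcases Nat.eq_zero_or_pos (retTime A n x) with h0 | h0
  · rw [h0, Nat.cast_zero, Real.zero_rpow hq'.ne, Real.zero_rpow (h.trans_lt hq').ne]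
  · exact Real.rpow_le_rpow_of_exponent_le (by exact_mod_cast h0) h

namespace Equilibrium

variable {φ : X A → ℝ} {μ : Measure (X A)} (H : Equilibrium φ μ)
include H

theorem tendsto_RSeq_of_ge {qs q : ℝ} (hqs : qs ∈ Ioo (-1 : ℝ) 0)
    (heq : (pressure A fun x => (1 - qs) * φ x) = supInt A φ) (hq : qs ≤ q) :
    Tendsto (RSeq A μ q) atTop (𝓝 ((pressure A fun x => (1 - q) * φ x : ℝ) : EReal)) := by
  rcases lt_trichotomy q 0 with h | rfl | h
  · refine H.tendsto_RSeq_of_neg (hqs.1.trans_le hq) h ?_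
    rw [← heq]
    exact H.strictAnti_pressure.antitone (by linarith : 1 - q ≤ 1 - qs)
  · rw [sub_zero, H.pressure_one]
    exact H.tendsto_RSeq_zero
  · exact H.tendsto_RSeq_of_pos h

theorem tendsto_RSeq_of_le {qs q : ℝ} (hqs : qs ∈ Ioo (-1 : ℝ) 0)
    (heq : (pressure A fun x => (1 - qs) * φ x) = supInt A φ) (hq : q ≤ qs) :
    Tendsto (RSeq A μ q) atTop (𝓝 ((supInt A φ : ℝ) : EReal)) := by
  refine tendsto_RSeq
    (fun L hL => H.eventually_le_moment_of_lt_supInt (hq.trans hqs.2.le) hL) fun L hL => ?_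
  filter_upwards [H.eventually_moment_le_of_neg hqs.1 hqs.2 heq.ge (heq.trans_lt hL)] with n hn
  exact (moment_mono hq hqs.2 n).trans hn

end Equilibrium
end Spectrum

/-- for a normalized potential `φ` with summable variation, not
cohomologous to `-log|A|`: `γ⁺(μ_φ)` exists and equals `sup_η ∫ φ dη`, the unique
solution `q*_φ` of `P((1-q)φ) = sup_η ∫ φ dη` lies in `(-1,0)`, the return-time
`L^q`-spectrum exists for every `q`, equals `P((1-q)φ)` for `q ≥ q*_φ` and equals
`γ⁺(μ_φ) = sup_η ∫ φ dη` for `q ≤ q*_φ`. -/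
theorem return_time_spectrum_equilibrium
    (hcard : 1 < Fintype.card A)
    (φ : X A → ℝ) (hφc : Continuous φ)
    (hvar : Summable (fun n => Var A φ (n + 1)))
    (hnorm : Normalized A φ)
    (μφ : Measure (X A)) (hμ : IsEqSt A φ μφ)
    (hnot : ¬ ∃ u : X A → ℝ, Continuous u ∧ ∀ x, φ x = u x - u (shift A x) - Real.log (Fintype.card A)) :
    ∃ γ : ℝ, Tendsto (gammaSeq A μφ) atTop (nhds γ) ∧ γ = supInt A φ ∧
      ∃ qs : ℝ, qs ∈ Set.Ioo (-1 : ℝ) 0 ∧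
        pressure A (fun x => (1 - qs) * φ x) = supInt A φ ∧
        (∀ q : ℝ, pressure A (fun x => (1 - q) * φ x) = supInt A φ → q = qs) ∧
        ∀ q : ℝ,
          (qs ≤ q → Tendsto (RSeq A μφ q) atTop
            (nhds ((pressure A (fun x => (1 - q) * φ x) : ℝ) : EReal))) ∧
          (q ≤ qs → Tendsto (RSeq A μφ q) atTop (nhds ((γ : ℝ) : EReal))) := by
  have H : Equilibrium φ μφ := ⟨hcard, hφc, hvar, hnorm, hμ⟩
  obtain ⟨qs, hqs, heq, huniq⟩ := H.existsUnique_pressure_eq hnot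
  exact ⟨supInt A φ, H.tendsto_gammaSeq, rfl, qs, hqs, heq, huniq, fun q =>
    ⟨H.tendsto_RSeq_of_ge hqs heq, H.tendsto_RSeq_of_le hqs heq⟩⟩

end RTSpec
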